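/- Let X be a GC_5 set of 21 nodes with no maximal line, and let A0 ∈ X be a node with m-d sequence (5,5,5,3,2) realized by the ordered used lines (ℓ1,ℓ2,ℓ3,ℓ4,ℓ5); set 𝒜 := X ∩ (ℓ1 ∪ ℓ2 ∪ ℓ3) (#𝒜 = 15) and ℬ := X \ 𝒜 (#ℬ = 6). Label the nodes of the GC_2 set ℬ as B1, B2, B3, M1, M2, M3 so that for {i,j,k} = {1,2,3} the line through B_j, B_k and M_i is a maximal line of ℬ (contains exactly these three nodes of ℬ). Suppose the line through B1 and M1 is a 5-node line of X which is used by all six nodes of a six-element subset 𝒜6 ⊆ 𝒜, and suppose ℓ is a 4-node line of X passing through B1 which is used by three nodes of 𝒜. Then all three of these nodes belong to 𝒜6. -/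

import Mathlib

open MvPolynomial

/-- Evaluation of a bivariate polynomial at a point of the real plane. -/
noncomputable def ev (p : MvPolynomial (Fin 2) ℝ) (A : ℝ × ℝ) : ℝ :=
  MvPolynomial.eval ![A.1, A.2] p

/-- A polynomial of total degree exactly 1, defining a line. -/
def IsLinePoly (l : MvPolynomial (Fin 2) ℝ) : Prop := l.totalDegree = 1

/-- The line (zero set) defined by a polynomial. -/
def lineSet (l : MvPolynomial (Fin 2) ℝ) : Set (ℝ × ℝ) := {A | ev l A = 0}

/-- The number of nodes of `X` lying on the line defined by `l`. -/
noncomputable def nodesOn (X : Set (ℝ × ℝ)) (l : MvPolynomial (Fin 2) ℝ) : ℕ :=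
  (X ∩ lineSet l).ncard

/-- `X` is an `n`-poised set: it has `N = (n+2)(n+1)/2` nodes and the only polynomial of
degree ≤ n vanishing on all of `X` is the zero polynomial. -/
def Poised (n : ℕ) (X : Set (ℝ × ℝ)) : Prop :=
  X.Finite ∧ X.ncard = (n + 2) * (n + 1) / 2 ∧
    ∀ p : MvPolynomial (Fin 2) ℝ, p.totalDegree ≤ n → (∀ A ∈ X, ev p A = 0) → p = 0

/-- `p` is an `n`-fundamental polynomial of the node `A` with respect to `X`. -/
def IsFund (n : ℕ) (X : Set (ℝ × ℝ)) (A : ℝ × ℝ) (p : MvPolynomial (Fin 2) ℝ) : Prop :=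
  p.totalDegree ≤ n ∧ ev p A = 1 ∧ ∀ B ∈ X, B ≠ A → ev p B = 0

/-- `X` is a `GC_n` set: it is `n`-poised and each fundamental polynomial is a product of
`n` linear (degree-1) polynomials. -/
def GCSet (n : ℕ) (X : Set (ℝ × ℝ)) : Prop :=
  Poised n X ∧ ∀ A ∈ X, ∃ p : MvPolynomial (Fin 2) ℝ, IsFund n X A p ∧
    ∃ f : Fin n → MvPolynomial (Fin 2) ℝ, (∀ i, IsLinePoly (f i)) ∧ p = ∏ i, f i

/-- The node `A` uses the line `l`: the linear polynomial `l` divides a fundamental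
polynomial of `A`. -/
def Uses (n : ℕ) (X : Set (ℝ × ℝ)) (A : ℝ × ℝ) (l : MvPolynomial (Fin 2) ℝ) : Prop :=
  ∃ p, IsFund n X A p ∧ l ∣ p

/-- `X` has no maximal line, i.e. no line passes through `n+1` nodes of `X`. -/
def NoMaximalLine (n : ℕ) (X : Set (ℝ × ℝ)) : Prop :=
  ∀ l : MvPolynomial (Fin 2) ℝ, IsLinePoly l → nodesOn X l ≠ n + 1

/-- Number of nodes of `X` on the line `l` which do not lie on any of the lines
`L 0, …, L (s-1)` (the primary node count of `l` at step `s`). -/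
noncomputable def resCount (X : Set (ℝ × ℝ)) (L : Fin 5 → MvPolynomial (Fin 2) ℝ)
    (s : Fin 5) (l : MvPolynomial (Fin 2) ℝ) : ℕ :=
  {B ∈ X | ev l B = 0 ∧ ∀ i : Fin 5, i < s → ev (L i) B ≠ 0}.ncard

/-- `L` is an m-line sequence of the node `A` of the `GC_5` set `X`: it enumerates the five
distinct used lines of `A` (a fundamental polynomial of `A` is, up to a constant, the
product of the `L i`), ordered greedily: at each step `s` the line `L s` has maximal
primary node count among the remaining used lines. -/
def MLineSeq (X : Set (ℝ × ℝ)) (A : ℝ × ℝ) (L : Fin 5 → MvPolynomial (Fin 2) ℝ) : Prop :=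
  (∀ i, IsLinePoly (L i)) ∧
  (∀ i j : Fin 5, i ≠ j → lineSet (L i) ≠ lineSet (L j)) ∧
  (∃ p : MvPolynomial (Fin 2) ℝ, IsFund 5 X A p ∧ ∃ c : ℝ, p = MvPolynomial.C c * ∏ i, L i) ∧
  (∀ s t : Fin 5, s ≤ t → resCount X L s (L t) ≤ resCount X L s (L s))

/-- The node `A` has m-distribution sequence `k`. -/
def HasMDSeq (X : Set (ℝ × ℝ)) (A : ℝ × ℝ) (k : Fin 5 → ℕ) : Prop :=
  ∃ L : Fin 5 → MvPolynomial (Fin 2) ℝ, MLineSeq X A L ∧ ∀ s, resCount X L s (L s) = k s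

theorem ev_mul (p q : MvPolynomial (Fin 2) ℝ) (A : ℝ × ℝ) : ev (p * q) A = ev p A * ev q A := by
  simp [ev]

theorem ev_prod {ι : Type*} (s : Finset ι) (f : ι → MvPolynomial (Fin 2) ℝ) (A : ℝ × ℝ) :
    ev (∏ i ∈ s, f i) A = ∏ i ∈ s, ev (f i) A := by
  simp [ev, map_prod]

theorem ev_C_mul (a : ℝ) (q : MvPolynomial (Fin 2) ℝ) (A : ℝ × ℝ) :
    ev (C a * q) A = a * ev q A := by
  simp [ev]

theorem IsLinePoly.exists_coeff {l : MvPolynomial (Fin 2) ℝ} (hl : IsLinePoly l) :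
    ∃ a b c : ℝ, (a ≠ 0 ∨ b ≠ 0) ∧
      l = C a * MvPolynomial.X 0 + C b * MvPolynomial.X 1 + C c := by
  have hform : l = C (coeff (Finsupp.single 0 1) l) * MvPolynomial.X 0 +
      C (coeff (Finsupp.single 1 1) l) * MvPolynomial.X 1 + C (coeff 0 l) := by
    ext m
    simp only [coeff_add, coeff_C_mul, coeff_X, coeff_C]
    by_cases h0 : m = 0
    · subst h0
      simp
    by_cases h1 : m = Finsupp.single 0 1
    · subst h1
      simp [Finsupp.single_left_inj, Ne.symm h0]
    by_cases h2 : m = Finsupp.single 1 1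
    · subst h2
      simp [Finsupp.single_left_inj, Ne.symm h0]
    rw [if_neg (Ne.symm h1), if_neg (Ne.symm h2), if_neg (Ne.symm h0)]
    simp only [mul_zero, add_zero]
    apply coeff_eq_zero_of_totalDegree_lt
    rw [show l.totalDegree = 1 from hl]
    have hsum : ∑ i ∈ m.support, m i = m 0 + m 1 := by
      rw [Finset.sum_subset (Finset.subset_univ _), Fin.sum_univ_two]
      intro i _ hi
      simpa using hi
    rw [hsum]
    by_contra hlt
    have hcases : (m 0 = 0 ∧ m 1 = 0) ∨ (m 0 = 1 ∧ m 1 = 0) ∨ (m 0 = 0 ∧ m 1 = 1) := by omega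
    rcases hcases with ⟨ha, hb⟩ | ⟨ha, hb⟩ | ⟨ha, hb⟩
    · apply h0
      ext i
      fin_cases i <;> simp [ha, hb]
    · apply h1
      ext i
      fin_cases i <;> simp [ha, hb]
    · apply h2
      ext i
      fin_cases i <;> simp [ha, hb]
  refine ⟨_, _, _, ?_, hform⟩
  by_contra hcon
  push Not at hcon
  rw [hcon.1, hcon.2] at hform
  have hdeg : l.totalDegree = 0 := by
    rw [hform]
    simp
  rw [show l.totalDegree = 1 from hl] at hdeg
  exact one_ne_zero hdeg

theorem ev_linear (a b c : ℝ) (A : ℝ × ℝ) :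
    ev (C a * MvPolynomial.X 0 + C b * MvPolynomial.X 1 + C c) A = a * A.1 + b * A.2 + c := by
  simp [ev]

theorem IsLinePoly.ne_zero {l : MvPolynomial (Fin 2) ℝ} (hl : IsLinePoly l) : l ≠ 0 := by
  rintro rfl
  simp [IsLinePoly] at hl

/-- On a line, every point is an affine combination of two given distinct points. -/
theorem exists_affine_combination {l : MvPolynomial (Fin 2) ℝ} (hl : IsLinePoly l) {P Q R : ℝ × ℝ}
    (hP : ev l P = 0) (hQ : ev l Q = 0) (hR : ev l R = 0) (hPQ : P ≠ Q) :
    ∃ s : ℝ, ∀ m, IsLinePoly m → ev m R = (1 - s) * ev m P + s * ev m Q := by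
  obtain ⟨a, b, c, hab, rfl⟩ := hl.exists_coeff
  rw [ev_linear] at hP hQ hR
  have key : ∃ s : ℝ, R.1 = (1 - s) * P.1 + s * Q.1 ∧ R.2 = (1 - s) * P.2 + s * Q.2 := by
    by_cases h1 : Q.1 - P.1 = 0
    · have h2 : Q.2 - P.2 ≠ 0 := by
        intro h2
        exact hPQ (Prod.ext (by linarith) (by linarith))
      have hb : b = 0 := by
        have : b * (Q.2 - P.2) = 0 := by linear_combination hQ - hP - a * h1
        exact (mul_eq_zero.1 this).resolve_right h2
      have ha : a ≠ 0 := by tauto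
      have hR1 : R.1 = P.1 := by
        subst hb
        have : a * (R.1 - P.1) = 0 := by linear_combination hR - hP
        linarith [(mul_eq_zero.1 this).resolve_left ha]
      refine ⟨(R.2 - P.2) / (Q.2 - P.2), ?_, ?_⟩
      · rw [hR1]
        linear_combination -(R.2 - P.2) / (Q.2 - P.2) * h1
      · field_simp
        ring
    · have hb : b ≠ 0 := by
        rintro rfl
        have ha : a ≠ 0 := by tauto
        have : a * (Q.1 - P.1) = 0 := by linear_combination hQ - hP
        exact h1 ((mul_eq_zero.1 this).resolve_left ha)
      refine ⟨(R.1 - P.1) / (Q.1 - P.1), ?_, ?_⟩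
      · field_simp
        ring
      · field_simp
        apply mul_left_cancel₀ hb
        linear_combination (Q.1 - P.1) * hR - (Q.1 - R.1) * hP - (R.1 - P.1) * hQ
  obtain ⟨s, h1, h2⟩ := key
  refine ⟨s, fun m hm => ?_⟩
  obtain ⟨a', b', c', -, rfl⟩ := hm.exists_coeff
  simp only [ev_linear, h1, h2]
  ring

theorem dvd_of_two_points {l m : MvPolynomial (Fin 2) ℝ} (hl : IsLinePoly l) (hm : IsLinePoly m)
    {P Q : ℝ × ℝ} (hPQ : P ≠ Q) (hlP : ev l P = 0) (hlQ : ev l Q = 0)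
    (hmP : ev m P = 0) (hmQ : ev m Q = 0) : l ∣ m := by
  obtain ⟨a, b, c, hab, rfl⟩ := hl.exists_coeff
  obtain ⟨a', b', c', -, rfl⟩ := hm.exists_coeff
  rw [ev_linear] at *
  have hdet : a * b' = a' * b := by
    have e1 : (a * b' - a' * b) * (Q.1 - P.1) = 0 := by
      linear_combination b' * hlQ - b' * hlP - b * hmQ + b * hmP
    have e2 : (a * b' - a' * b) * (Q.2 - P.2) = 0 := by
      linear_combination -a' * hlQ + a' * hlP + a * hmQ - a * hmP
    by_contra hne
    have hne' : a * b' - a' * b ≠ 0 := sub_ne_zero.2 hne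
    have f1 := (mul_eq_zero.1 e1).resolve_left hne'
    have f2 := (mul_eq_zero.1 e2).resolve_left hne'
    exact hPQ (Prod.ext (by linarith) (by linarith))
  have key : ∃ k : ℝ, a' = k * a ∧ b' = k * b ∧ c' = k * c := by
    rcases hab with h | h
    · have e1 : b' = a' / a * b := by
        field_simp
        linear_combination hdet
      refine ⟨a' / a, by field_simp, e1, ?_⟩
      have e0 : a' = a' / a * a := by field_simp
      linear_combination hmP - a' / a * hlP - P.1 * e0 - P.2 * e1
    · have e1 : a' = b' / b * a := by
        field_simp
        linear_combination -hdet
      refine ⟨b' / b, e1, by field_simp, ?_⟩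
      have e0 : b' = b' / b * b := by field_simp
      linear_combination hmP - b' / b * hlP - P.1 * e1 - P.2 * e0
  obtain ⟨k, rfl, rfl, rfl⟩ := key
  refine ⟨C k, ?_⟩
  simp only [C_mul]
  ring

theorem ev_eq_zero_of_dvd {l m : MvPolynomial (Fin 2) ℝ} (h : l ∣ m) {A : ℝ × ℝ}
    (hA : ev l A = 0) : ev m A = 0 := by
  obtain ⟨k, rfl⟩ := h
  rw [ev_mul, hA, zero_mul]

theorem infinite_lineSet {l : MvPolynomial (Fin 2) ℝ} (hl : IsLinePoly l) :
    (lineSet l).Infinite := by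
  obtain ⟨a, b, c, hab, rfl⟩ := hl.exists_coeff
  have hne : a * a + b * b ≠ 0 := by
    rcases hab with h | h
    · have := mul_self_pos.2 h
      nlinarith [mul_self_nonneg b]
    · have := mul_self_pos.2 h
      nlinarith [mul_self_nonneg a]
  let g : ℝ → ℝ × ℝ := fun s =>
    (-a * c / (a * a + b * b) - s * b, -b * c / (a * a + b * b) + s * a)
  refine Set.infinite_of_injective_forall_mem (f := g) ?_ ?_
  · intro s s' h
    simp only [g, Prod.mk.injEq] at h
    rcases hab with h' | h'
    · exact mul_right_cancel₀ h' (by linarith [h.2])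
    · exact mul_right_cancel₀ h' (by linarith [h.1])
  · intro s
    change ev _ (g s) = 0
    rw [ev_linear]
    have hinv : (a * a + b * b) * (a * a + b * b)⁻¹ = 1 := mul_inv_cancel₀ hne
    simp only [g, div_eq_mul_inv]
    linear_combination -c * hinv

/-- A line has a point, outside any finite set, at which finitely many other lines do not
vanish. -/
theorem exists_point_on_line {l : MvPolynomial (Fin 2) ℝ} (hl : IsLinePoly l)
    (T : Finset (MvPolynomial (Fin 2) ℝ)) (hT : ∀ m ∈ T, IsLinePoly m ∧ ¬ l ∣ m)
    (K : Finset (ℝ × ℝ)) : ∃ Z, ev l Z = 0 ∧ Z ∉ K ∧ ∀ m ∈ T, ev m Z ≠ 0 := by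
  have hfin : (⋃ m ∈ T, {Z | ev l Z = 0 ∧ ev m Z = 0}).Finite := by
    refine T.finite_toSet.biUnion fun m hm => Set.Subsingleton.finite ?_
    intro P hP Q hQ
    by_contra hPQ
    exact (hT m hm).2 (dvd_of_two_points hl (hT m hm).1 hPQ hP.1 hQ.1 hP.2 hQ.2)
  obtain ⟨Z, hZ, hZ'⟩ := ((infinite_lineSet hl).sdiff (hfin.union K.finite_toSet)).nonempty
  refine ⟨Z, hZ, fun h => hZ' (Or.inr h), fun m hm h => hZ' (Or.inl ?_)⟩
  simp only [Set.mem_iUnion]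
  exact ⟨m, hm, hZ, h⟩

theorem dvd_of_dvd_prod {ι : Type*} {l : MvPolynomial (Fin 2) ℝ} (hl : IsLinePoly l)
    (I : Finset ι) (f : ι → MvPolynomial (Fin 2) ℝ) (hf : ∀ i ∈ I, IsLinePoly (f i))
    (h : l ∣ ∏ i ∈ I, f i) : ∃ i ∈ I, l ∣ f i := by
  classical
  by_contra hcon
  push Not at hcon
  obtain ⟨Z, hZ, -, hZ'⟩ := exists_point_on_line hl (I.image f) (by
    intro m hm
    obtain ⟨i, hi, rfl⟩ := Finset.mem_image.1 hm
    exact ⟨hf i hi, hcon i hi⟩) ∅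
  have := ev_eq_zero_of_dvd h hZ
  rw [ev_prod, Finset.prod_eq_zero_iff] at this
  obtain ⟨i, hi, h0⟩ := this
  exact hZ' _ (Finset.mem_image_of_mem f hi) h0

/-- More points of a line than covering lines force the line among the covering ones. -/
theorem exists_dvd_of_cover {ι : Type*} {r : MvPolynomial (Fin 2) ℝ} (hr : IsLinePoly r)
    (I : Finset ι) (m : ι → MvPolynomial (Fin 2) ℝ) (hm : ∀ i, IsLinePoly (m i))
    (S : Finset (ℝ × ℝ)) (hS : ∀ A ∈ S, ev r A = 0)
    (hcov : ∀ A ∈ S, ∃ i ∈ I, ev (m i) A = 0) (hcard : I.card < S.card) :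
    ∃ i ∈ I, r ∣ m i := by
  obtain ⟨A₀, hA₀⟩ := Finset.card_pos.1 (Nat.zero_lt_of_lt hcard)
  have : Nonempty ι := ⟨(hcov A₀ hA₀).choose⟩
  choose! g hgI hg using hcov
  obtain ⟨A, hA, B, hB, hAB, h⟩ := Finset.exists_ne_map_eq_of_card_lt_of_maps_to hcard hgI
  refine ⟨g A, hgI A hA, dvd_of_two_points hr (hm _) hAB (hS A hA) (hS B hB) (hg A hA) ?_⟩
  rw [h]
  exact hg B hB

/-- If as many lines as points cover points of a line not among them, each line covers one. -/
theorem forall_exists_of_cover {ι : Type*} {r : MvPolynomial (Fin 2) ℝ} (hr : IsLinePoly r)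
    (I : Finset ι) (m : ι → MvPolynomial (Fin 2) ℝ) (hm : ∀ i, IsLinePoly (m i))
    (S : Finset (ℝ × ℝ)) (hS : ∀ A ∈ S, ev r A = 0)
    (hcov : ∀ A ∈ S, ∃ i ∈ I, ev (m i) A = 0) (hcard : I.card ≤ S.card)
    (hnd : ∀ i ∈ I, ¬ r ∣ m i) : ∀ i ∈ I, ∃ A ∈ S, ev (m i) A = 0 := by
  classical
  intro i hi
  by_contra hcon
  push Not at hcon
  obtain ⟨j, hj, h⟩ := exists_dvd_of_cover hr (I.erase i) m hm S hS (by
    intro A hA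
    obtain ⟨j, hj, h⟩ := hcov A hA
    refine ⟨j, Finset.mem_erase.2 ⟨?_, hj⟩, h⟩
    rintro rfl
    exact hcon A hA h) (by
    rw [Finset.card_erase_of_mem hi]
    have := Finset.card_pos.2 ⟨i, hi⟩
    omega)
  exact hnd j (Finset.mem_of_mem_erase hj) h

theorem dvd_symm_of_isLinePoly {l m : MvPolynomial (Fin 2) ℝ} (hl : IsLinePoly l)
    (hm : IsLinePoly m) (h : l ∣ m) : m ∣ l := by
  obtain ⟨P, hP, Q, hQ, hPQ⟩ := (infinite_lineSet hl).nontrivial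
  exact dvd_of_two_points hm hl hPQ (ev_eq_zero_of_dvd h hP) (ev_eq_zero_of_dvd h hQ) hP hQ

/-- The nodes of `X` on the line `l`. -/
noncomputable def nodes (X : Finset (ℝ × ℝ)) (l : MvPolynomial (Fin 2) ℝ) : Finset (ℝ × ℝ) :=
  X.filter fun A => ev l A = 0

theorem mem_nodes {X : Finset (ℝ × ℝ)} {l : MvPolynomial (Fin 2) ℝ} {A : ℝ × ℝ} :
    A ∈ nodes X l ↔ A ∈ X ∧ ev l A = 0 := by
  simp [nodes]

theorem nodesOn_coe (X : Finset (ℝ × ℝ)) (l : MvPolynomial (Fin 2) ℝ) :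
    nodesOn (X : Set (ℝ × ℝ)) l = (nodes X l).card := by
  have hset : (X : Set (ℝ × ℝ)) ∩ lineSet l = ↑(nodes X l) := by
    ext A
    simp [mem_nodes, lineSet]
  rw [nodesOn, hset, Set.ncard_coe_finset]

/-- `c` is a linear dependency, with respect to polynomials of degree at most `k`, between the
point evaluations at the points of `X`. -/
def IsRel (X : Finset (ℝ × ℝ)) (k : ℕ) (c : ℝ × ℝ → ℝ) : Prop :=
  ∀ q : MvPolynomial (Fin 2) ℝ, q.totalDegree ≤ k → ∑ A ∈ X, c A * ev q A = 0

theorem totalDegree_linear_le (a b c : ℝ) :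
    (C a * MvPolynomial.X 0 + C b * MvPolynomial.X 1 + C c :
      MvPolynomial (Fin 2) ℝ).totalDegree ≤ 1 := by
  refine (totalDegree_add _ _).trans (max_le ((totalDegree_add _ _).trans (max_le ?_ ?_)) ?_)
  · exact (totalDegree_mul _ _).trans (by simp)
  · exact (totalDegree_mul _ _).trans (by simp)
  · simp

theorem exists_line_separating {A B : ℝ × ℝ} (h : A ≠ B) :
    ∃ m : MvPolynomial (Fin 2) ℝ, m.totalDegree ≤ 1 ∧ ev m B = 0 ∧ ev m A ≠ 0 := by
  refine ⟨C (A.1 - B.1) * MvPolynomial.X 0 + C (A.2 - B.2) * MvPolynomial.X 1 +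
    C (-((A.1 - B.1) * B.1 + (A.2 - B.2) * B.2)), totalDegree_linear_le _ _ _, ?_, ?_⟩
  · rw [ev_linear]
    ring
  · rw [ev_linear]
    intro h0
    have hsq : (A.1 - B.1) ^ 2 + (A.2 - B.2) ^ 2 = 0 := by linear_combination h0
    have h1 : A.1 - B.1 = 0 := by nlinarith [sq_nonneg (A.1 - B.1), sq_nonneg (A.2 - B.2)]
    have h2 : A.2 - B.2 = 0 := by nlinarith [sq_nonneg (A.1 - B.1), sq_nonneg (A.2 - B.2)]
    exact h (Prod.ext (by linarith) (by linarith))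

theorem ev_list_prod_ne_zero {ls : List (MvPolynomial (Fin 2) ℝ)} {A : ℝ × ℝ} :
    ev ls.prod A ≠ 0 ↔ ∀ m ∈ ls, ev m A ≠ 0 := by
  induction ls with
  | nil => simp [ev]
  | cons a ls ih => simp [ev_mul, ih]

theorem totalDegree_list_prod_le_length {ls : List (MvPolynomial (Fin 2) ℝ)}
    (h : ∀ m ∈ ls, IsLinePoly m) : ls.prod.totalDegree ≤ ls.length := by
  induction ls with
  | nil => simp
  | cons a ls ih =>
    rw [List.prod_cons, List.length_cons]
    have h1 := totalDegree_mul a ls.prod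
    have h2 : a.totalDegree = 1 := h a (by simp)
    have h3 := ih fun m hm => h m (by simp [hm])
    omega

/-- A dependency vanishes off a union of lines as soon as its support has few points off that
union. -/
theorem IsRel.eq_zero_off_lines {X : Finset (ℝ × ℝ)} {k : ℕ} {c : ℝ × ℝ → ℝ} (h : IsRel X k c)
    (ls : List (MvPolynomial (Fin 2) ℝ)) (hls : ∀ m ∈ ls, IsLinePoly m) (S : Finset (ℝ × ℝ))
    (hS : ∀ A ∈ X, c A ≠ 0 → (∀ m ∈ ls, ev m A ≠ 0) → A ∈ S)
    (hcard : S.card + ls.length ≤ k + 1) :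
    ∀ A ∈ X, (∀ m ∈ ls, ev m A ≠ 0) → c A = 0 := by
  classical
  intro A hA hAl
  by_contra hc
  have hAS := hS A hA hc hAl
  have hsep : ∀ B : ℝ × ℝ, ∃ m : MvPolynomial (Fin 2) ℝ, m.totalDegree ≤ 1 ∧
      (B ≠ A → ev m B = 0) ∧ ev m A ≠ 0 := by
    intro B
    by_cases hBA : B = A
    · exact ⟨1, by simp, fun h => absurd hBA h, by simp [ev]⟩
    · obtain ⟨m, h1, h2, h3⟩ := exists_line_separating (Ne.symm hBA)
      exact ⟨m, h1, fun _ => h2, h3⟩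
  choose s hs1 hs2 hs3 using hsep
  have hsum := h (ls.prod * ∏ B ∈ S.erase A, s B) (by
    refine (totalDegree_mul _ _).trans ?_
    have h1 := totalDegree_list_prod_le_length hls
    have h2 : (∏ B ∈ S.erase A, s B).totalDegree ≤ (S.erase A).card := by
      refine (totalDegree_finsetProd _ _).trans ?_
      simpa using Finset.sum_le_sum fun B (_ : B ∈ S.erase A) => hs1 B
    rw [Finset.card_erase_of_mem hAS] at h2
    have := Finset.card_pos.2 ⟨A, hAS⟩
    omega)
  rw [Finset.sum_eq_single_of_mem A hA] at hsum
  · rw [ev_mul, ev_prod] at hsum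
    refine mul_ne_zero hc (mul_ne_zero (ev_list_prod_ne_zero.2 hAl) ?_) hsum
    exact Finset.prod_ne_zero_iff.2 fun B _ => hs3 B
  · intro B hB hBA
    rw [ev_mul, ev_prod]
    by_cases hcB : c B = 0
    · rw [hcB, zero_mul]
    by_cases hBl : ∀ m ∈ ls, ev m B ≠ 0
    · have h0 : ∏ i ∈ S.erase A, ev (s i) B = 0 :=
        Finset.prod_eq_zero (i := B) (Finset.mem_erase.2 ⟨hBA, hS B hB hcB hBl⟩) (hs2 B hBA)
      rw [h0]
      simp
    · rw [← ev_list_prod_ne_zero, not_not] at hBl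
      simp [hBl]

theorem IsFund.unique {n : ℕ} {X : Set (ℝ × ℝ)} (hX : Poised n X) {A : ℝ × ℝ}
    {p q : MvPolynomial (Fin 2) ℝ} (hp : IsFund n X A p) (hq : IsFund n X A q) : p = q := by
  refine sub_eq_zero.1 (hX.2.2 (p - q) ?_ ?_)
  · exact (totalDegree_sub _ _).trans (max_le hp.1 hq.1)
  · intro B hB
    have hsub : ev (p - q) B = ev p B - ev q B := by simp [ev]
    rw [hsub]
    by_cases hBA : B = A
    · rw [hBA, hp.2.1, hq.2.1, sub_self]
    · rw [hp.2.2 B hB hBA, hq.2.2 B hB hBA, sub_self]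

theorem GCSet.lagrange {n : ℕ} {X : Finset (ℝ × ℝ)} (hX : Poised n (X : Set (ℝ × ℝ)))
    {F : ℝ × ℝ → MvPolynomial (Fin 2) ℝ} (hF : ∀ A ∈ X, IsFund n X A (F A))
    {p : MvPolynomial (Fin 2) ℝ} (hp : p.totalDegree ≤ n) (Z : ℝ × ℝ) :
    ev p Z = ∑ A ∈ X, ev p A * ev (F A) Z := by
  have hev : ∀ W, ev (p - ∑ A ∈ X, C (ev p A) * F A) W =
      ev p W - ∑ A ∈ X, ev p A * ev (F A) W := by
    intro W
    simp [ev, map_sum]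
  have h0 : p - ∑ A ∈ X, C (ev p A) * F A = 0 := by
    refine hX.2.2 _ ?_ ?_
    · refine (totalDegree_sub _ _).trans (max_le hp ?_)
      refine totalDegree_finsetSum_le fun A hA => ?_
      exact (totalDegree_mul _ _).trans (by simpa using (hF A hA).1)
    · intro B hB
      rw [hev, Finset.sum_eq_single_of_mem B hB, (hF B hB).2.1, mul_one, sub_self]
      intro A hA hAB
      rw [(hF A hA).2.2 B hB (Ne.symm hAB), mul_zero]
  have h1 := hev Z
  rw [h0] at h1
  have h2 : ev 0 Z = 0 := by simp [ev]
  linarith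

/-- A dependency for polynomials of degree at most 4 supported off the line `l`. -/
def LineRel (X : Finset (ℝ × ℝ)) (l : MvPolynomial (Fin 2) ℝ) (c : ℝ × ℝ → ℝ) : Prop :=
  IsRel X 4 c ∧ ∀ A ∈ X, ev l A = 0 → c A = 0

theorem LineRel.combination {X : Finset (ℝ × ℝ)} {l : MvPolynomial (Fin 2) ℝ}
    {c d : ℝ × ℝ → ℝ} (hc : LineRel X l c) (hd : LineRel X l d) (a b : ℝ) :
    LineRel X l fun A => a * c A - b * d A := by
  constructor
  · intro q hq
    have h : ∀ A, (a * c A - b * d A) * ev q A = a * (c A * ev q A) - b * (d A * ev q A) :=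
      fun A => by ring
    simp only [h, Finset.sum_sub_distrib, ← Finset.mul_sum, hc.1 q hq, hd.1 q hq]
    simp
  · intro A hA hl
    simp [hc.2 A hA hl, hd.2 A hA hl]

theorem lineRel_of_point {X : Finset (ℝ × ℝ)} (hX : Poised 5 (X : Set (ℝ × ℝ)))
    {F : ℝ × ℝ → MvPolynomial (Fin 2) ℝ} (hF : ∀ A ∈ X, IsFund 5 X A (F A))
    {l : MvPolynomial (Fin 2) ℝ} (hl : IsLinePoly l) {Z : ℝ × ℝ} (hZ : ev l Z = 0) :
    LineRel X l fun A => ev l A * ev (F A) Z := by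
  constructor
  · intro q hq
    have hdeg : (l * q).totalDegree ≤ 5 := by
      have h1 := totalDegree_mul l q
      have h2 : l.totalDegree = 1 := hl
      omega
    have h := GCSet.lagrange hX hF hdeg Z
    rw [ev_mul, hZ, zero_mul] at h
    rw [h]
    refine Finset.sum_congr rfl fun A _ => ?_
    rw [ev_mul]
    ring
  · intro A _ h
    simp [h]

theorem LineRel.eq_zero_of_uses {X : Finset (ℝ × ℝ)} {l : MvPolynomial (Fin 2) ℝ}
    {c : ℝ × ℝ → ℝ} (hc : LineRel X l c) (hl : IsLinePoly l) {A : ℝ × ℝ} (hA : A ∈ X)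
    (h : Uses 5 X A l) : c A = 0 := by
  obtain ⟨p, hp, q, rfl⟩ := h
  have hq0 : q ≠ 0 := by
    rintro rfl
    have := hp.2.1
    simp [ev] at this
  have hdeg := totalDegree_mul_of_isDomain hl.ne_zero hq0
  have hl1 : l.totalDegree = 1 := hl
  have hle := hp.1
  have hsum := hc.1 q (by omega)
  rw [Finset.sum_eq_single_of_mem A hA] at hsum
  · have h1 := hp.2.1
    rw [ev_mul] at h1
    refine (mul_eq_zero.1 hsum).resolve_right fun h => ?_
    rw [h, mul_zero] at h1
    exact zero_ne_one h1
  · intro B hB hBA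
    have h1 := hp.2.2 B hB hBA
    rw [ev_mul] at h1
    rcases mul_eq_zero.1 h1 with h | h
    · rw [hc.2 B hB h, zero_mul]
    · rw [h, mul_zero]

/-- The four lines, besides `l`, used by a node `A` using `l`. -/
theorem Uses.exists_lines {X : Finset (ℝ × ℝ)} (hX : GCSet 5 (X : Set (ℝ × ℝ)))
    {l : MvPolynomial (Fin 2) ℝ} (hl : IsLinePoly l) {A : ℝ × ℝ} (hA : A ∈ X)
    (h : Uses 5 X A l) :
    ev l A ≠ 0 ∧ ∃ m : Fin 4 → MvPolynomial (Fin 2) ℝ, (∀ i, IsLinePoly (m i)) ∧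
      (∀ i, ev (m i) A ≠ 0) ∧ (∀ i r, r ∣ m i → Uses 5 X A r) ∧
      ∀ B ∈ X, B ≠ A → ev l B ≠ 0 → ∃ i, ev (m i) B = 0 := by
  obtain ⟨p, hp, hlp⟩ := h
  obtain ⟨p', hp', f, hf, hpf⟩ := hX.2 A hA
  obtain rfl := IsFund.unique hX.1 hp hp'
  subst hpf
  obtain ⟨i, -, hi⟩ := dvd_of_dvd_prod hl Finset.univ f (fun i _ => hf i) hlp
  have hne : ∀ j, ev (f j) A ≠ 0 := by
    intro j hj
    have h1 := hp.2.1
    rw [ev_prod, Finset.prod_eq_zero (Finset.mem_univ j) hj] at h1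
    exact zero_ne_one h1
  refine ⟨fun h => hne i (ev_eq_zero_of_dvd hi h), fun j => f (i.succAbove j), fun j => hf _,
    fun j => hne _, ?_, ?_⟩
  · intro j r hr
    exact ⟨_, hp, hr.trans (Finset.dvd_prod_of_mem f (Finset.mem_univ _))⟩
  · intro B hB hBA hlB
    have h1 := hp.2.2 B hB hBA
    rw [ev_prod, Finset.prod_eq_zero_iff] at h1
    obtain ⟨k, -, hk⟩ := h1
    rcases Fin.eq_self_or_eq_succAbove i k with rfl | ⟨j, rfl⟩
    · exact absurd (ev_eq_zero_of_dvd (dvd_symm_of_isLinePoly hl (hf _) hi) hk) hlB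
    · exact ⟨j, hk⟩

theorem GCSet.card_nodes_le {X : Finset (ℝ × ℝ)} (hX : GCSet 5 (X : Set (ℝ × ℝ)))
    (hnm : NoMaximalLine 5 (X : Set (ℝ × ℝ))) {l : MvPolynomial (Fin 2) ℝ} (hl : IsLinePoly l) :
    (nodes X l).card ≤ 5 := by
  have hne : (nodes X l).card ≠ 6 := by
    have h := hnm l hl
    rwa [nodesOn_coe] at h
  by_contra hcon
  obtain ⟨A, hA⟩ : (nodes X l).Nonempty := Finset.card_pos.1 (by omega)
  obtain ⟨hAX, hlA⟩ := mem_nodes.1 hA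
  obtain ⟨p, hp, f, hf, rfl⟩ := hX.2 A hAX
  have hcard := Finset.card_erase_of_mem hA
  obtain ⟨i, -, hi⟩ := exists_dvd_of_cover hl Finset.univ f hf ((nodes X l).erase A)
    (fun B hB => (mem_nodes.1 (Finset.mem_of_mem_erase hB)).2) (by
      intro B hB
      obtain ⟨hBA, hB⟩ := Finset.mem_erase.1 hB
      have h1 := hp.2.2 B (mem_nodes.1 hB).1 hBA
      rw [ev_prod, Finset.prod_eq_zero_iff] at h1
      exact h1) (by
      rw [hcard, Finset.card_univ, Fintype.card_fin]
      omega)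
  have h1 := hp.2.1
  rw [ev_prod, Finset.prod_eq_zero (Finset.mem_univ i) (ev_eq_zero_of_dvd hi hlA)] at h1
  exact zero_ne_one h1

/-- The support of a dependency. -/
noncomputable def relSupport (X : Finset (ℝ × ℝ)) (c : ℝ × ℝ → ℝ) : Finset (ℝ × ℝ) :=
  X.filter fun A => c A ≠ 0

theorem mem_relSupport {X : Finset (ℝ × ℝ)} {c : ℝ × ℝ → ℝ} {A : ℝ × ℝ} :
    A ∈ relSupport X c ↔ A ∈ X ∧ c A ≠ 0 := by
  simp [relSupport]

/-- A nontrivial dependency in degree 4 with at most 11 support points, which are covered by at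
most four lines, none with more than five nodes, is carried by two of these lines, each with at
least five support points off the other one. -/
theorem IsRel.exists_two_lines {X : Finset (ℝ × ℝ)} {c : ℝ × ℝ → ℝ} (hc : IsRel X 4 c)
    (hne : (relSupport X c).Nonempty) (m : Fin 4 → MvPolynomial (Fin 2) ℝ)
    (hm : ∀ i, IsLinePoly (m i)) (hle : ∀ i, (nodes X (m i)).card ≤ 5)
    (hcard : (relSupport X c).card ≤ 11) (J : Finset (Fin 4))
    (hcov : ∀ A ∈ relSupport X c, ∃ i ∈ J, ev (m i) A = 0) :
    ∃ j ∈ J, ∃ k ∈ J, j ≠ k ∧ (∀ A ∈ relSupport X c, ev (m j) A = 0 ∨ ev (m k) A = 0) ∧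
      5 ≤ ((relSupport X c).filter fun A => ev (m j) A = 0 ∧ ev (m k) A ≠ 0).card ∧
      5 ≤ ((relSupport X c).filter fun A => ev (m k) A = 0 ∧ ev (m j) A ≠ 0).card := by
  classical
  obtain ⟨I, ⟨hIJ, hIcov⟩, hmin⟩ := (measure (Finset.card (α := Fin 4))).wf.has_min
    {I | I ⊆ J ∧ ∀ A ∈ relSupport X c, ∃ i ∈ I, ev (m i) A = 0} ⟨J, subset_rfl, hcov⟩
  let P : Fin 4 → Finset (ℝ × ℝ) := fun i =>
    (relSupport X c).filter fun A => ev (m i) A = 0 ∧ ∀ j ∈ I, j ≠ i → ev (m j) A ≠ 0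
  have hP : ∀ i ∈ I, 7 ≤ (P i).card + I.card := by
    intro i hi
    have hpos := Finset.card_pos.2 ⟨i, hi⟩
    have hnc : ¬ ∀ A ∈ relSupport X c, ∃ j ∈ I.erase i, ev (m j) A = 0 := by
      intro h
      refine hmin (I.erase i) ⟨(Finset.erase_subset _ _).trans hIJ, h⟩ ?_
      change (I.erase i).card < I.card
      rw [Finset.card_erase_of_mem hi]
      omega
    push Not at hnc
    obtain ⟨A, hA, hAn⟩ := hnc
    by_contra hlt
    refine (mem_relSupport.1 hA).2 (hc.eq_zero_off_lines ((I.erase i).toList.map m) ?_ (P i) ?_ ?_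
      A (mem_relSupport.1 hA).1 ?_)
    · intro q hq
      obtain ⟨j, -, rfl⟩ := List.mem_map.1 hq
      exact hm j
    · intro B hB hcB hBl
      have hBs := mem_relSupport.2 ⟨hB, hcB⟩
      have hoff : ∀ j ∈ I, j ≠ i → ev (m j) B ≠ 0 := fun j hj hji =>
        hBl (m j) (List.mem_map.2 ⟨j, by simp [hj, hji], rfl⟩)
      refine Finset.mem_filter.2 ⟨hBs, ?_, hoff⟩
      obtain ⟨j, hj, h0⟩ := hIcov B hBs
      by_cases hji : j = i
      · rwa [hji] at h0
      · exact absurd h0 (hoff j hj hji)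
    · rw [List.length_map, Finset.length_toList, Finset.card_erase_of_mem hi]
      omega
    · intro q hq
      obtain ⟨j, hj, rfl⟩ := List.mem_map.1 hq
      exact hAn j (Finset.mem_toList.1 hj)
  have hsum : ∑ i ∈ I, (P i).card ≤ 11 := by
    rw [← Finset.card_biUnion]
    · refine (Finset.card_le_card ?_).trans hcard
      exact Finset.biUnion_subset.2 fun i _ => Finset.filter_subset _ _
    · intro i hi j hj hij
      refine Finset.disjoint_left.2 fun A hAi hAj => ?_
      exact (Finset.mem_filter.1 hAj).2.2 i hi hij (Finset.mem_filter.1 hAi).2.1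
  have hmul : I.card * (7 - I.card) ≤ 11 := by
    refine le_trans ?_ hsum
    rw [← smul_eq_mul]
    exact Finset.card_nsmul_le_sum _ _ _ fun i hi => by have := hP i hi; omega
  have hI4 : I.card ≤ 4 := by simpa using Finset.card_le_univ I
  have hI2 : I.card = 2 := by
    generalize hn : I.card = n at *
    interval_cases n
    · obtain ⟨A, hA⟩ := hne
      obtain ⟨i, hi, -⟩ := hIcov A hA
      simp [Finset.card_eq_zero.1 hn] at hi
    · obtain ⟨i, rfl⟩ := Finset.card_eq_one.1 hn
      have h1 := hP i (by simp)
      have h2 : (P i).card ≤ (nodes X (m i)).card := Finset.card_le_card fun A hA =>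
        mem_nodes.2 ⟨(mem_relSupport.1 (Finset.mem_filter.1 hA).1).1, (Finset.mem_filter.1 hA).2.1⟩
      have h3 := hle i
      omega
    · rfl
    · omega
    · omega
  obtain ⟨j, k, hjk, rfl⟩ := Finset.card_eq_two.1 hI2
  refine ⟨j, hIJ (by simp), k, hIJ (by simp), hjk, ?_, ?_, ?_⟩
  · intro A hA
    obtain ⟨i, hi, h0⟩ := hIcov A hA
    rcases Finset.mem_insert.1 hi with rfl | hi
    · exact Or.inl h0
    · rw [Finset.mem_singleton] at hi
      exact Or.inr (hi ▸ h0)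
  · have h1 := hP j (by simp)
    have h2 : (P j).card ≤ _ := Finset.card_le_card (t := (relSupport X c).filter
      fun A => ev (m j) A = 0 ∧ ev (m k) A ≠ 0) fun A hA => by
        obtain ⟨a, b, d⟩ := Finset.mem_filter.1 hA
        exact Finset.mem_filter.2 ⟨a, b, d k (by simp) hjk.symm⟩
    omega
  · have h1 := hP k (by simp)
    have h2 : (P k).card ≤ _ := Finset.card_le_card (t := (relSupport X c).filter
      fun A => ev (m k) A = 0 ∧ ev (m j) A ≠ 0) fun A hA => by
        obtain ⟨a, b, d⟩ := Finset.mem_filter.1 hA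
        exact Finset.mem_filter.2 ⟨a, b, d j (by simp) hjk⟩
    omega

/-- A `GC_5` set without maximal lines, fifteen nodes of which lie on three node-disjoint 5-node
lines `L i`, the other six being arranged as in a `GC_2` set with maximal lines `t₁`, `t₂`, `t₃`
which meet in the nodes `B i`. -/
structure Config (X : Finset (ℝ × ℝ)) (L : Fin 3 → MvPolynomial (Fin 2) ℝ)
    (t₁ t₂ t₃ : MvPolynomial (Fin 2) ℝ) (B₁ B₂ B₃ M₁ M₂ M₃ : ℝ × ℝ) : Prop where
  gc : GCSet 5 (X : Set (ℝ × ℝ))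
  card : X.card = 21
  card_nodes_le : ∀ m, IsLinePoly m → (nodes X m).card ≤ 5
  line : ∀ i, IsLinePoly (L i)
  card_nodes : ∀ i, (nodes X (L i)).card = 5
  disj : ∀ i j, i ≠ j → ∀ A ∈ X, ev (L i) A = 0 → ev (L j) A ≠ 0
  off_iff : ∀ A, (A ∈ X ∧ ∀ i, ev (L i) A ≠ 0) ↔
    A = B₁ ∨ A = B₂ ∨ A = B₃ ∨ A = M₁ ∨ A = M₂ ∨ A = M₃
  line₁ : IsLinePoly t₁
  line₂ : IsLinePoly t₂
  line₃ : IsLinePoly t₃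
  on₁ : ev t₁ B₂ = 0 ∧ ev t₁ B₃ = 0 ∧ ev t₁ M₁ = 0
  on₂ : ev t₂ B₁ = 0 ∧ ev t₂ B₃ = 0 ∧ ev t₂ M₂ = 0
  on₃ : ev t₃ B₁ = 0 ∧ ev t₃ B₂ = 0 ∧ ev t₃ M₃ = 0
  off₁ : ev t₁ B₁ ≠ 0 ∧ ev t₁ M₂ ≠ 0 ∧ ev t₁ M₃ ≠ 0
  off₂ : ev t₂ B₂ ≠ 0 ∧ ev t₂ M₁ ≠ 0 ∧ ev t₂ M₃ ≠ 0
  off₃ : ev t₃ B₃ ≠ 0 ∧ ev t₃ M₁ ≠ 0 ∧ ev t₃ M₂ ≠ 0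
  ne₁ : B₁ ≠ M₂ ∧ B₁ ≠ M₃
  ne₂ : B₂ ≠ M₁ ∧ B₂ ≠ M₃
  ne₃ : B₃ ≠ M₁ ∧ B₃ ≠ M₂

section Config

variable {X : Finset (ℝ × ℝ)} {L : Fin 3 → MvPolynomial (Fin 2) ℝ}
  {t₁ t₂ t₃ : MvPolynomial (Fin 2) ℝ} {B₁ B₂ B₃ M₁ M₂ M₃ : ℝ × ℝ}

theorem Config.swap (h : Config X L t₁ t₂ t₃ B₁ B₂ B₃ M₁ M₂ M₃) :
    Config X L t₁ t₃ t₂ B₁ B₃ B₂ M₁ M₃ M₂ where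
  gc := h.gc
  card := h.card
  card_nodes_le := h.card_nodes_le
  line := h.line
  card_nodes := h.card_nodes
  disj := h.disj
  off_iff A := (h.off_iff A).trans (by tauto)
  line₁ := h.line₁
  line₂ := h.line₃
  line₃ := h.line₂
  on₁ := ⟨h.on₁.2.1, h.on₁.1, h.on₁.2.2⟩
  on₂ := h.on₃
  on₃ := h.on₂
  off₁ := ⟨h.off₁.1, h.off₁.2.2, h.off₁.2.1⟩
  off₂ := h.off₃
  off₃ := h.off₂
  ne₁ := ⟨h.ne₁.2, h.ne₁.1⟩
  ne₂ := h.ne₃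
  ne₃ := h.ne₂

theorem Config.mem_off (h : Config X L t₁ t₂ t₃ B₁ B₂ B₃ M₁ M₂ M₃) {A : ℝ × ℝ}
    (hA : A = B₁ ∨ A = B₂ ∨ A = B₃ ∨ A = M₁ ∨ A = M₂ ∨ A = M₃) :
    A ∈ X ∧ ∀ i, ev (L i) A ≠ 0 :=
  (h.off_iff A).2 hA

/-- The fundamental polynomial of a node off the lines `L i` which is separated from the other
ones by two lines. -/
theorem Config.ev_fund (h : Config X L t₁ t₂ t₃ B₁ B₂ B₃ M₁ M₂ M₃) {P : ℝ × ℝ}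
    (hP : P = B₁ ∨ P = B₂ ∨ P = B₃ ∨ P = M₁ ∨ P = M₂ ∨ P = M₃)
    {u v p : MvPolynomial (Fin 2) ℝ} (hu : IsLinePoly u) (hv : IsLinePoly v)
    (hz : ∀ A, A ≠ P → (A = B₁ ∨ A = B₂ ∨ A = B₃ ∨ A = M₁ ∨ A = M₂ ∨ A = M₃) →
      ev u A * ev v A = 0) (huP : ev u P ≠ 0) (hvP : ev v P ≠ 0)
    (hp : IsFund 5 (X : Set (ℝ × ℝ)) P p) :
    ∃ β : ℝ, β ≠ 0 ∧ ∀ Z, ev p Z = β * ((∏ i, ev (L i) Z) * (ev u Z * ev v Z)) := by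
  obtain ⟨hPX, hPL⟩ := h.mem_off hP
  set q : MvPolynomial (Fin 2) ℝ := (∏ i, L i) * (u * v) with hq
  have hev : ∀ Z, ev q Z = (∏ i, ev (L i) Z) * (ev u Z * ev v Z) := fun Z => by
    rw [hq, ev_mul, ev_mul, ev_prod]
  have hqP : ev q P ≠ 0 := by
    rw [hev]
    exact mul_ne_zero (Finset.prod_ne_zero_iff.2 fun i _ => hPL i) (mul_ne_zero huP hvP)
  have hdeg : q.totalDegree ≤ 5 := by
    have h1 : q.totalDegree ≤ _ := totalDegree_mul (∏ i, L i) (u * v)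
    have h2 := totalDegree_mul u v
    have h3 : (∏ i, L i).totalDegree ≤ 3 := by
      refine (totalDegree_finsetProd _ _).trans ?_
      simp [show ∀ i, (L i).totalDegree = 1 from h.line]
    rw [show u.totalDegree = 1 from hu, show v.totalDegree = 1 from hv] at h2
    omega
  have hfund : IsFund 5 (X : Set (ℝ × ℝ)) P (C (ev q P)⁻¹ * q) := by
    refine ⟨(totalDegree_mul _ _).trans (by simpa using hdeg), ?_, ?_⟩
    · rw [ev_C_mul, inv_mul_cancel₀ hqP]
    · intro A hA hAP
      rw [ev_C_mul, hev A]
      by_cases hAL : ∀ i, ev (L i) A ≠ 0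
      · rw [hz A hAP ((h.off_iff A).1 ⟨hA, hAL⟩)]
        simp
      · push Not at hAL
        obtain ⟨i, hi⟩ := hAL
        rw [Finset.prod_eq_zero (Finset.mem_univ i) hi]
        simp
  refine ⟨(ev q P)⁻¹, inv_ne_zero hqP, fun Z => ?_⟩
  rw [IsFund.unique h.gc.1 hp hfund, ev_C_mul, hev Z]

theorem Config.ev_fund_M₁ (h : Config X L t₁ t₂ t₃ B₁ B₂ B₃ M₁ M₂ M₃)
    {p : MvPolynomial (Fin 2) ℝ} (hp : IsFund 5 (X : Set (ℝ × ℝ)) M₁ p) :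
    ∃ β : ℝ, β ≠ 0 ∧ ∀ Z, ev p Z = β * ((∏ i, ev (L i) Z) * (ev t₂ Z * ev t₃ Z)) := by
  refine h.ev_fund (by simp) h.line₂ h.line₃ ?_ h.off₂.2.1 h.off₃.2.1 hp
  rintro A hA (rfl | rfl | rfl | rfl | rfl | rfl)
  · simp [h.on₂.1]
  · simp [h.on₃.2.1]
  · simp [h.on₂.2.1]
  · exact absurd rfl hA
  · simp [h.on₂.2.2]
  · simp [h.on₃.2.2]

theorem Config.ev_fund_M₂ (h : Config X L t₁ t₂ t₃ B₁ B₂ B₃ M₁ M₂ M₃)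
    {p : MvPolynomial (Fin 2) ℝ} (hp : IsFund 5 (X : Set (ℝ × ℝ)) M₂ p) :
    ∃ β : ℝ, β ≠ 0 ∧ ∀ Z, ev p Z = β * ((∏ i, ev (L i) Z) * (ev t₁ Z * ev t₃ Z)) := by
  refine h.ev_fund (by simp) h.line₁ h.line₃ ?_ h.off₁.2.1 h.off₃.2.2 hp
  rintro A hA (rfl | rfl | rfl | rfl | rfl | rfl)
  · simp [h.on₃.1]
  · simp [h.on₃.2.1]
  · simp [h.on₁.2.1]
  · simp [h.on₁.2.2]
  · exact absurd rfl hA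
  · simp [h.on₃.2.2]

/-- The nodes other than `B₁` and `M₁` off the lines `L i` do not lie on the line through
`B₁` and `M₁`. -/
theorem Config.not_on_median (h : Config X L t₁ t₂ t₃ B₁ B₂ B₃ M₁ M₂ M₃)
    {r : MvPolynomial (Fin 2) ℝ} (hr : IsLinePoly r) (hrB : ev r B₁ = 0) (hrM : ev r M₁ = 0) :
    ev r B₂ ≠ 0 ∧ ev r B₃ ≠ 0 ∧ ev r M₂ ≠ 0 ∧ ev r M₃ ≠ 0 := by
  have h12 : B₁ ≠ B₂ := fun e => h.off₁.1 (e ▸ h.on₁.1)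
  have h13 : B₁ ≠ B₃ := fun e => h.off₁.1 (e ▸ h.on₁.2.1)
  refine ⟨fun h0 => h.off₃.2.1 ?_, fun h0 => h.off₂.2.1 ?_, fun h0 => h.off₂.2.1 ?_,
    fun h0 => h.off₃.2.1 ?_⟩
  · exact ev_eq_zero_of_dvd (dvd_of_two_points hr h.line₃ h12 hrB h0 h.on₃.1 h.on₃.2.1) hrM
  · exact ev_eq_zero_of_dvd (dvd_of_two_points hr h.line₂ h13 hrB h0 h.on₂.1 h.on₂.2.1) hrM
  · exact ev_eq_zero_of_dvd (dvd_of_two_points hr h.line₂ h.ne₁.1 hrB h0 h.on₂.1 h.on₂.2.2) hrM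
  · exact ev_eq_zero_of_dvd (dvd_of_two_points hr h.line₃ h.ne₁.2 hrB h0 h.on₃.1 h.on₃.2.2) hrM

/-- If six nodes on the lines `L i` use the line through `B₁` and `M₁`, and this line has five
nodes, then they are all its users, and the other ten nodes off this line lie on two node-disjoint
5-node lines, one through `B₂` and `M₂` and one through `B₃` and `M₃`. -/
theorem Config.exists_medians (h : Config X L t₁ t₂ t₃ B₁ B₂ B₃ M₁ M₂ M₃)
    {r : MvPolynomial (Fin 2) ℝ} (hr : IsLinePoly r) (hrB : ev r B₁ = 0) (hrM : ev r M₁ = 0)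
    (hr5 : (nodes X r).card = 5) {U : Finset (ℝ × ℝ)} (hUX : U ⊆ X) (hU : U.card = 6)
    (hUL : ∀ P ∈ U, ∃ i, ev (L i) P = 0) (huse : ∀ P ∈ U, Uses 5 (X : Set (ℝ × ℝ)) P r) :
    (∀ D ∈ X, Uses 5 (X : Set (ℝ × ℝ)) D r → D ∈ U) ∧
    ∃ r₂ r₃, IsLinePoly r₂ ∧ IsLinePoly r₃ ∧ ev r₂ B₂ = 0 ∧ ev r₂ M₂ = 0 ∧
      ev r₃ B₃ = 0 ∧ ev r₃ M₃ = 0 ∧ (nodes X r₂).card = 5 ∧ (nodes X r₃).card = 5 ∧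
      (∀ A ∈ X, ev r₂ A = 0 → ev r A ≠ 0 ∧ ev r₃ A ≠ 0) ∧ ∀ A ∈ X, ev r₃ A = 0 → ev r A ≠ 0 := by
  classical
  obtain ⟨nB2, nB3, nM2, nM3⟩ := h.not_on_median hr hrB hrM
  obtain ⟨hB1X, hB1L⟩ := h.mem_off (A := B₁) (by simp)
  obtain ⟨hB2X, hB2L⟩ := h.mem_off (A := B₂) (by simp)
  obtain ⟨hB3X, hB3L⟩ := h.mem_off (A := B₃) (by simp)
  obtain ⟨hM1X, hM1L⟩ := h.mem_off (A := M₁) (by simp)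
  obtain ⟨hM2X, hM2L⟩ := h.mem_off (A := M₂) (by simp)
  obtain ⟨hM3X, hM3L⟩ := h.mem_off (A := M₃) (by simp)
  have hexF : ∀ A : ℝ × ℝ, ∃ p, A ∈ X → IsFund 5 (X : Set (ℝ × ℝ)) A p := by
    intro A
    by_cases hA : A ∈ X
    · obtain ⟨p, hp, -⟩ := h.gc.2 A hA
      exact ⟨p, fun _ => hp⟩
    · exact ⟨0, fun hA' => absurd hA' hA⟩
  choose F hF using hexF
  obtain ⟨β, hβ, hFM⟩ := h.ev_fund_M₂ (hF M₂ hM2X)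
  obtain ⟨Z, hZ, -, hZT⟩ := exists_point_on_line hr (insert t₁ (insert t₃ (Finset.univ.image L)))
    (by
      intro m hm
      rw [Finset.mem_insert, Finset.mem_insert, Finset.mem_image] at hm
      rcases hm with rfl | rfl | ⟨i, -, rfl⟩
      · exact ⟨h.line₁, fun hd => h.off₁.1 (ev_eq_zero_of_dvd hd hrB)⟩
      · exact ⟨h.line₃, fun hd => h.off₃.2.1 (ev_eq_zero_of_dvd hd hrM)⟩
      · exact ⟨h.line i, fun hd => hB1L i (ev_eq_zero_of_dvd hd hrB)⟩) ∅
  set c : ℝ × ℝ → ℝ := fun A => ev r A * ev (F A) Z with hcdef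
  have hc : LineRel X r c := lineRel_of_point h.gc.1 hF hr hZ
  have hcM : c M₂ ≠ 0 := by
    refine mul_ne_zero nM2 ?_
    rw [hFM]
    refine mul_ne_zero hβ (mul_ne_zero (Finset.prod_ne_zero_iff.2 fun i _ => hZT _ ?_)
      (mul_ne_zero (hZT _ ?_) (hZT _ ?_))) <;> simp
  have hUr : ∀ P ∈ U, ev r P ≠ 0 := fun P hP =>
    (Uses.exists_lines h.gc hr (hUX hP) (huse P hP)).1
  set W := (X \ nodes X r) \ U with hW
  have hWcard : W.card = 10 := by
    rw [hW, Finset.card_sdiff_of_subset, Finset.card_sdiff_of_subset, h.card, hr5, hU]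
    · exact Finset.filter_subset _ _
    · intro P hP
      exact Finset.mem_sdiff.2 ⟨hUX hP, fun hPr => hUr P hP (mem_nodes.1 hPr).2⟩
  have hmemW : ∀ A, A ∈ W ↔ A ∈ X ∧ ev r A ≠ 0 ∧ A ∉ U := by
    intro A
    simp only [hW, Finset.mem_sdiff, mem_nodes]
    tauto
  have hsub : relSupport X c ⊆ W := by
    intro A hA
    obtain ⟨hAX, hcA⟩ := mem_relSupport.1 hA
    exact (hmemW A).2 ⟨hAX, fun h0 => hcA (hc.2 A hAX h0),
      fun hAU => hcA (hc.eq_zero_of_uses hr hAX (huse A hAU))⟩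
  obtain ⟨P, hP⟩ : U.Nonempty := Finset.card_pos.1 (by omega)
  obtain ⟨-, m, hm, -, -, hcov⟩ := Uses.exists_lines h.gc hr (hUX hP) (huse P hP)
  obtain ⟨j, -, k, -, -, hjk, hj5, hk5⟩ := hc.1.exists_two_lines
    ⟨M₂, mem_relSupport.2 ⟨hM2X, hcM⟩⟩ m hm (fun i => h.card_nodes_le _ (hm i))
    ((Finset.card_le_card hsub).trans (by omega)) Finset.univ (by
      intro A hA
      obtain ⟨hAX, hAr, hAU⟩ := (hmemW A).1 (hsub hA)
      obtain ⟨i, hi⟩ := hcov A hAX (fun e => hAU (e ▸ hP)) hAr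
      exact ⟨i, Finset.mem_univ i, hi⟩)
  have hsupp : relSupport X c = W := by
    refine Finset.eq_of_subset_of_card_le hsub ?_
    have hdisj : Disjoint ((relSupport X c).filter fun A => ev (m j) A = 0 ∧ ev (m k) A ≠ 0)
        ((relSupport X c).filter fun A => ev (m k) A = 0 ∧ ev (m j) A ≠ 0) :=
      Finset.disjoint_left.2 fun A h1 h2 =>
        (Finset.mem_filter.1 h2).2.2 (Finset.mem_filter.1 h1).2.1
    have hle := Finset.card_le_card (Finset.union_subset
      (Finset.filter_subset (fun A => ev (m j) A = 0 ∧ ev (m k) A ≠ 0) (relSupport X c))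
      (Finset.filter_subset (fun A => ev (m k) A = 0 ∧ ev (m j) A ≠ 0) (relSupport X c)))
    rw [Finset.card_union_of_disjoint hdisj] at hle
    omega
  rw [hsupp] at hjk hj5 hk5
  have key : ∀ i i', 5 ≤ (W.filter fun A => ev (m i) A = 0 ∧ ev (m i') A ≠ 0).card →
      (nodes X (m i)).card = 5 ∧ ∀ A ∈ X, ev (m i) A = 0 → A ∈ W ∧ ev (m i') A ≠ 0 := by
    intro i i' h5
    have hs : (W.filter fun A => ev (m i) A = 0 ∧ ev (m i') A ≠ 0) ⊆ nodes X (m i) := by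
      intro A hA
      obtain ⟨h1, h2, -⟩ := Finset.mem_filter.1 hA
      exact mem_nodes.2 ⟨((hmemW A).1 h1).1, h2⟩
    have hle := Finset.card_le_card hs
    have hle' := h.card_nodes_le _ (hm i)
    refine ⟨by omega, fun A hA h0 => ?_⟩
    have heq := Finset.eq_of_subset_of_card_le hs (by omega)
    have hA' : A ∈ nodes X (m i) := mem_nodes.2 ⟨hA, h0⟩
    rw [← heq] at hA'
    obtain ⟨h1, -, h2⟩ := Finset.mem_filter.1 hA'
    exact ⟨h1, h2⟩
  have hjkey := key j k hj5
  have hkkey := key k j hk5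
  have main : ∀ μ ν : MvPolynomial (Fin 2) ℝ, IsLinePoly μ → IsLinePoly ν →
      (nodes X μ).card = 5 → (nodes X ν).card = 5 →
      (∀ A ∈ X, ev μ A = 0 → A ∈ W ∧ ev ν A ≠ 0) → (∀ A ∈ X, ev ν A = 0 → A ∈ W ∧ ev μ A ≠ 0) →
      (∀ A ∈ W, ev μ A = 0 ∨ ev ν A = 0) → ev μ B₂ = 0 →
      ∃ r₂ r₃, IsLinePoly r₂ ∧ IsLinePoly r₃ ∧ ev r₂ B₂ = 0 ∧ ev r₂ M₂ = 0 ∧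
        ev r₃ B₃ = 0 ∧ ev r₃ M₃ = 0 ∧ (nodes X r₂).card = 5 ∧ (nodes X r₃).card = 5 ∧
        (∀ A ∈ X, ev r₂ A = 0 → ev r A ≠ 0 ∧ ev r₃ A ≠ 0) ∧
        ∀ A ∈ X, ev r₃ A = 0 → ev r A ≠ 0 := by
    intro μ ν hμ hν hμ5 hν5 hμW hνW hcovW hμB2
    have hnotU : ∀ A, (∀ i, ev (L i) A ≠ 0) → A ∉ U := fun A hA hAU => by
      obtain ⟨i, hi⟩ := hUL A hAU
      exact hA i hi
    have hμB1 : ev μ B₁ ≠ 0 := fun h0 => ((hmemW _).1 (hμW _ hB1X h0).1).2.1 hrB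
    have hνB1 : ev ν B₁ ≠ 0 := fun h0 => ((hmemW _).1 (hνW _ hB1X h0).1).2.1 hrB
    have hμM1 : ev μ M₁ ≠ 0 := fun h0 => ((hmemW _).1 (hμW _ hM1X h0).1).2.1 hrM
    have hcases := fun A hA hL hrA => hcovW A ((hmemW A).2 ⟨hA, hrA, hnotU A hL⟩)
    have hB23 : B₂ ≠ B₃ := fun e => h.off₂.1 (e ▸ h.on₂.2.1)
    have hμM3 : ev μ M₃ ≠ 0 := fun h0 => hμB1 (ev_eq_zero_of_dvd
      (dvd_of_two_points h.line₃ hμ h.ne₂.2 h.on₃.2.1 h.on₃.2.2 hμB2 h0) h.on₃.1)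
    have hμB3 : ev μ B₃ ≠ 0 := fun h0 => hμM1 (ev_eq_zero_of_dvd
      (dvd_of_two_points h.line₁ hμ hB23 h.on₁.1 h.on₁.2.1 hμB2 h0) h.on₁.2.2)
    have hνM3 := (hcases _ hM3X hM3L nM3).resolve_left hμM3
    have hνB3 := (hcases _ hB3X hB3L nB3).resolve_left hμB3
    have hνM2 : ev ν M₂ ≠ 0 := fun h0 => hνB1 (ev_eq_zero_of_dvd
      (dvd_of_two_points h.line₂ hν h.ne₃.2 h.on₂.2.1 h.on₂.2.2 hνB3 h0) h.on₂.1)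
    have hμM2 := (hcases _ hM2X hM2L nM2).resolve_right hνM2
    exact ⟨μ, ν, hμ, hν, hμB2, hμM2, hνB3, hνM3, hμ5, hν5,
      fun A hA h0 => ⟨((hmemW _).1 (hμW A hA h0).1).2.1, (hμW A hA h0).2⟩,
      fun A hA h0 => ((hmemW _).1 (hνW A hA h0).1).2.1⟩
  constructor
  · intro D hD hDu
    by_contra hDU
    have hDW : D ∈ W := (hmemW D).2 ⟨hD, (Uses.exists_lines h.gc hr hD hDu).1, hDU⟩
    rw [← hsupp] at hDW
    exact (mem_relSupport.1 hDW).2 (hc.eq_zero_of_uses hr hD hDu)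
  · have hB2W : B₂ ∈ W := (hmemW _).2 ⟨hB2X, nB2, fun hB2U => by
      obtain ⟨i, hi⟩ := hUL _ hB2U
      exact hB2L i hi⟩
    rcases hjk B₂ hB2W with h0 | h0
    · exact main _ _ (hm j) (hm k) hjkey.1 hkkey.1 hjkey.2 hkkey.2 hjk h0
    · exact main _ _ (hm k) (hm j) hkkey.1 hjkey.1 hkkey.2 hjkey.2
        (fun A hA => (hjk A hA).symm) h0

theorem ev_ne_zero_of_dvd {l m : MvPolynomial (Fin 2) ℝ} (hl : IsLinePoly l) (hm : IsLinePoly m)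
    (h : l ∣ m) {A : ℝ × ℝ} (hA : ev l A ≠ 0) : ev m A ≠ 0 := fun h0 =>
  hA (ev_eq_zero_of_dvd (dvd_symm_of_isLinePoly hl hm h) h0)

theorem exists_other_indices (i : Fin 3) :
    ∃ j k : Fin 3, i ≠ j ∧ i ≠ k ∧ j ≠ k ∧ ∀ x, x = i ∨ x = j ∨ x = k := by
  revert i
  decide

theorem exists_third_index {i j : Fin 3} (h : i ≠ j) : ∃ k, ∀ x, x = i ∨ x = j ∨ x = k := by
  revert i j
  decide

/-- A line meeting the union of the `L i` in at most one node is used by no node of that union. -/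
theorem Config.not_uses_of_single (h : Config X L t₁ t₂ t₃ B₁ B₂ B₃ M₁ M₂ M₃)
    {l : MvPolynomial (Fin 2) ℝ} (hl : IsLinePoly l) {E : ℝ × ℝ} (hEX : E ∈ X)
    (hE : ∀ A ∈ X, ev l A = 0 → (∃ i, ev (L i) A = 0) → A = E) {D : ℝ × ℝ} (hD : D ∈ X)
    {a : Fin 3} (hDa : ev (L a) D = 0) : ¬ Uses 5 (X : Set (ℝ × ℝ)) D l := by
  classical
  intro hu
  obtain ⟨-, m, hm, hmD, -, hcov⟩ := Uses.exists_lines h.gc hl hD hu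
  obtain ⟨b, c, hab, hac, hbc, hEc⟩ : ∃ b c, a ≠ b ∧ a ≠ c ∧ b ≠ c ∧ ev (L c) E ≠ 0 := by
    obtain ⟨b, c, hab, hac, hbc, -⟩ := exists_other_indices a
    by_cases h0 : ev (L c) E = 0
    · exact ⟨c, b, hac, hab, hbc.symm, h.disj c b hbc.symm E hEX h0⟩
    · exact ⟨b, c, hab, hac, hbc, h0⟩
  have hcov' : ∀ x, ∀ A ∈ nodes X (L x), A ≠ E → A ≠ D → ∃ i, ev (m i) A = 0 := by
    intro x A hA hAE hAD
    obtain ⟨hAX, hAx⟩ := mem_nodes.1 hA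
    exact hcov A hAX hAD fun h0 => hAE (hE A hAX h0 ⟨x, hAx⟩)
  have hoff : ∀ x y i, x ≠ y → L y ∣ m i → ∀ A ∈ nodes X (L x), ev (m i) A ≠ 0 := by
    intro x y i hxy hd A hA
    obtain ⟨hAX, hAx⟩ := mem_nodes.1 hA
    exact ev_ne_zero_of_dvd (h.line y) (hm i) hd (h.disj x y hxy A hAX hAx)
  obtain ⟨i, -, hi⟩ := exists_dvd_of_cover (h.line c) Finset.univ m hm (nodes X (L c))
    (fun A hA => (mem_nodes.1 hA).2) (by
      intro A hA
      obtain ⟨i, hi⟩ := hcov' c A hA (fun e => hEc (e ▸ (mem_nodes.1 hA).2))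
        (fun e => h.disj a c hac D hD hDa (e ▸ (mem_nodes.1 hA).2))
      exact ⟨i, Finset.mem_univ i, hi⟩) (by simp [h.card_nodes])
  have hcardb := (nodes X (L b)).pred_card_le_card_erase (a := E)
  rw [h.card_nodes] at hcardb
  obtain ⟨j, hj, hjd⟩ := exists_dvd_of_cover (h.line b) (Finset.univ.erase i) m hm
    ((nodes X (L b)).erase E) (fun A hA => (mem_nodes.1 (Finset.mem_of_mem_erase hA)).2) (by
      intro A hA
      obtain ⟨hAE, hA⟩ := Finset.mem_erase.1 hA
      obtain ⟨j, hj⟩ := hcov' b A hA hAE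
        (fun e => h.disj a b hab D hD hDa (e ▸ (mem_nodes.1 hA).2))
      refine ⟨j, Finset.mem_erase.2 ⟨?_, Finset.mem_univ j⟩, hj⟩
      rintro rfl
      exact hoff b c j hbc hi A hA hj) (by
      rw [Finset.card_erase_of_mem (Finset.mem_univ i), Finset.card_univ, Fintype.card_fin]
      omega)
  have hcarda := (nodes X (L a)).pred_card_le_card_erase (a := E)
  have hcarda' := ((nodes X (L a)).erase E).pred_card_le_card_erase (a := D)
  rw [h.card_nodes] at hcarda
  obtain ⟨k, -, hkd⟩ := exists_dvd_of_cover (h.line a) ((Finset.univ.erase i).erase j) m hm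
    (((nodes X (L a)).erase E).erase D)
    (fun A hA => (mem_nodes.1 (Finset.mem_of_mem_erase (Finset.mem_of_mem_erase hA))).2) (by
      intro A hA
      obtain ⟨hAD, hA⟩ := Finset.mem_erase.1 hA
      obtain ⟨hAE, hA⟩ := Finset.mem_erase.1 hA
      obtain ⟨k, hk⟩ := hcov' a A hA hAE hAD
      refine ⟨k, Finset.mem_erase.2 ⟨?_, Finset.mem_erase.2 ⟨?_, Finset.mem_univ k⟩⟩, hk⟩
      · rintro rfl
        exact hoff a b k hab hjd A hA hk
      · rintro rfl
        exact hoff a c k hac hi A hA hk) (by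
      rw [Finset.card_erase_of_mem hj, Finset.card_erase_of_mem (Finset.mem_univ i),
        Finset.card_univ, Fintype.card_fin]
      omega)
  exact hmD k (ev_eq_zero_of_dvd hkd hDa)

/-- The nodes on the line `m` but not on the line `l`. -/
noncomputable def offNodes (X : Finset (ℝ × ℝ)) (m l : MvPolynomial (Fin 2) ℝ) :
    Finset (ℝ × ℝ) :=
  X.filter fun A => ev m A = 0 ∧ ev l A ≠ 0

theorem mem_offNodes {X : Finset (ℝ × ℝ)} {m l : MvPolynomial (Fin 2) ℝ} {A : ℝ × ℝ} :
    A ∈ offNodes X m l ↔ A ∈ X ∧ ev m A = 0 ∧ ev l A ≠ 0 := by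
  simp [offNodes]

/-- A 4-node line with one node `B₁` off the lines `L i`, and one node on each of them. -/
structure SimpleLine (X : Finset (ℝ × ℝ)) (L : Fin 3 → MvPolynomial (Fin 2) ℝ)
    (B₁ B₂ B₃ M₁ M₂ M₃ : ℝ × ℝ) (l : MvPolynomial (Fin 2) ℝ) : Prop where
  line : IsLinePoly l
  card : (nodes X l).card = 4
  on : ev l B₁ = 0
  offB₂ : ev l B₂ ≠ 0
  offB₃ : ev l B₃ ≠ 0
  offM₁ : ev l M₁ ≠ 0
  offM₂ : ev l M₂ ≠ 0
  offM₃ : ev l M₃ ≠ 0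
  card_off : ∀ i, (offNodes X (L i) l).card = 4

variable {l : MvPolynomial (Fin 2) ℝ}

/-- The dependencies off a simple line form a space of dimension greater than one. -/
theorem Config.exists_rel_zero_at (h : Config X L t₁ t₂ t₃ B₁ B₂ B₃ M₁ M₂ M₃)
    (hl : SimpleLine X L B₁ B₂ B₃ M₁ M₂ M₃ l) (A : ℝ × ℝ) :
    ∃ c, LineRel X l c ∧ (relSupport X c).Nonempty ∧ c A = 0 := by
  classical
  obtain ⟨hB1X, hB1L⟩ := h.mem_off (A := B₁) (by simp)
  obtain ⟨hM1X, hM1L⟩ := h.mem_off (A := M₁) (by simp)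
  obtain ⟨hM2X, hM2L⟩ := h.mem_off (A := M₂) (by simp)
  have hexF : ∀ A : ℝ × ℝ, ∃ p, A ∈ X → IsFund 5 (X : Set (ℝ × ℝ)) A p := by
    intro A
    by_cases hA : A ∈ X
    · obtain ⟨p, hp, -⟩ := h.gc.2 A hA
      exact ⟨p, fun _ => hp⟩
    · exact ⟨0, fun hA' => absurd hA' hA⟩
  choose F hF using hexF
  obtain ⟨α, hα, hF1⟩ := h.ev_fund_M₁ (hF M₁ hM1X)
  obtain ⟨β, hβ, hF2⟩ := h.ev_fund_M₂ (hF M₂ hM2X)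
  have hT : ∀ m ∈ insert t₁ (insert t₂ (insert t₃ (Finset.univ.image L))),
      IsLinePoly m ∧ ¬ l ∣ m := by
    intro m hm
    rw [Finset.mem_insert, Finset.mem_insert, Finset.mem_insert, Finset.mem_image] at hm
    rcases hm with rfl | rfl | rfl | ⟨i, -, rfl⟩
    · exact ⟨h.line₁, fun hd => h.off₁.1 (ev_eq_zero_of_dvd hd hl.on)⟩
    · exact ⟨h.line₂, fun hd => ev_ne_zero_of_dvd hl.line h.line₂ hd hl.offB₃ h.on₂.2.1⟩
    · exact ⟨h.line₃, fun hd => ev_ne_zero_of_dvd hl.line h.line₃ hd hl.offB₂ h.on₃.2.1⟩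
    · exact ⟨h.line i, fun hd => hB1L i (ev_eq_zero_of_dvd hd hl.on)⟩
  obtain ⟨Z, hZ, -, hZT⟩ := exists_point_on_line hl.line _ hT ∅
  obtain ⟨Y, hY, hYZ, hYT⟩ := exists_point_on_line hl.line _ hT {Z}
  have hZL : ∏ i, ev (L i) Z ≠ 0 := Finset.prod_ne_zero_iff.2 fun i _ => hZT _ (by simp)
  have hYL : ∏ i, ev (L i) Y ≠ 0 := Finset.prod_ne_zero_iff.2 fun i _ => hYT _ (by simp)
  have hZ2 : ev t₂ Z ≠ 0 := hZT _ (by simp)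
  have hZ3 : ev t₃ Z ≠ 0 := hZT _ (by simp)
  have hY3 : ev t₃ Y ≠ 0 := hYT _ (by simp)
  by_contra hcon
  have hzero : ∀ c, LineRel X l c → c A = 0 → ∀ P ∈ X, c P = 0 := by
    intro c hc hcA P hP
    by_contra hcP
    exact hcon ⟨c, hc, ⟨P, mem_relSupport.2 ⟨hP, hcP⟩⟩, hcA⟩
  have hcZ : LineRel X l fun P => ev l P * ev (F P) Z := lineRel_of_point h.gc.1 hF hl.line hZ
  have hcY : LineRel X l fun P => ev l P * ev (F P) Y := lineRel_of_point h.gc.1 hF hl.line hY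
  have hb : ev l A * ev (F A) Z ≠ 0 := by
    intro h0
    have := hzero _ hcZ h0 M₁ hM1X
    simp only [hF1, mul_eq_zero] at this
    have := hl.offM₁
    tauto
  have hcomb := hzero _ (hcZ.combination hcY (ev l A * ev (F A) Y) (ev l A * ev (F A) Z)) (by ring)
  have e1 := hcomb M₁ hM1X
  have e2 := hcomb M₂ hM2X
  simp only [hF1] at e1
  simp only [hF2] at e2
  generalize ev l A * ev (F A) Y = a at *
  generalize ev l A * ev (F A) Z = b at *
  have e1' : a * (∏ i, ev (L i) Z) * ev t₃ Z * ev t₂ Z =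
      b * (∏ i, ev (L i) Y) * ev t₃ Y * ev t₂ Y := by
    apply mul_left_cancel₀ (mul_ne_zero hl.offM₁ hα)
    linear_combination e1
  have e2' : a * (∏ i, ev (L i) Z) * ev t₃ Z * ev t₁ Z =
      b * (∏ i, ev (L i) Y) * ev t₃ Y * ev t₁ Y := by
    apply mul_left_cancel₀ (mul_ne_zero hl.offM₂ hβ)
    linear_combination e2
  have hcross : ev t₂ Z * ev t₁ Y = ev t₂ Y * ev t₁ Z := by
    apply mul_left_cancel₀ (mul_ne_zero (mul_ne_zero hb hYL) hY3)
    linear_combination ev t₁ Z * e1' - ev t₂ Z * e2'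
  obtain ⟨s, hs⟩ := exists_affine_combination hl.line hZ hY hl.on
    (fun e => hYZ (Finset.mem_singleton.2 e.symm))
  have s1 := hs t₁ h.line₁
  have s2 := hs t₂ h.line₂
  rw [h.on₂.1] at s2
  refine mul_ne_zero hZ2 h.off₁.1 ?_
  linear_combination ev t₂ Z * s1 - ev t₁ Z * s2 + s * hcross

theorem Config.off_iff_of_indices (h : Config X L t₁ t₂ t₃ B₁ B₂ B₃ M₁ M₂ M₃) {A : ℝ × ℝ}
    {i j k : Fin 3} (hx : ∀ x, x = i ∨ x = j ∨ x = k) (hA : A ∈ X) (hi : ev (L i) A ≠ 0)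
    (hj : ev (L j) A ≠ 0) (hk : ev (L k) A ≠ 0) :
    A = B₁ ∨ A = B₂ ∨ A = B₃ ∨ A = M₁ ∨ A = M₂ ∨ A = M₃ :=
  (h.off_iff A).1 ⟨hA, fun x => by rcases hx x with rfl | rfl | rfl <;> assumption⟩

theorem LineRel.mem_offNodes_of_ne_zero {c : ℝ × ℝ → ℝ} (hc : LineRel X l c) {A : ℝ × ℝ}
    (hA : A ∈ X) (hcA : c A ≠ 0) {i : Fin 3}
    (hi : ev (L i) A = 0) : A ∈ offNodes X (L i) l :=
  mem_offNodes.2 ⟨hA, hi, fun h0 => hcA (hc.2 A hA h0)⟩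

/-- A dependency off `l` vanishing off the lines `L i` and at some further node is trivial. -/
theorem Config.rel_eq_zero (h : Config X L t₁ t₂ t₃ B₁ B₂ B₃ M₁ M₂ M₃)
    (hl : SimpleLine X L B₁ B₂ B₃ M₁ M₂ M₃ l) {c : ℝ × ℝ → ℝ} (hc : LineRel X l c)
    (hoff : ∀ A ∈ X, (∀ i, ev (L i) A ≠ 0) → c A = 0) {D : ℝ × ℝ} (hD : D ∈ X)
    (hDl : ev l D ≠ 0) (hcD : c D = 0) {i : Fin 3} (hDi : ev (L i) D = 0) :
    ∀ A ∈ X, c A = 0 := by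
  classical
  obtain ⟨j, k, -, -, -, hx⟩ := exists_other_indices i
  have h1 := hc.1.eq_zero_off_lines [L j, L k] (by simp [h.line])
    ((offNodes X (L i) l).erase D) (by
      intro A hA hcA hAl
      have hAi : ev (L i) A = 0 := by
        by_contra hAi
        refine hcA (hoff A hA fun x => ?_)
        rcases hx x with rfl | rfl | rfl
        · exact hAi
        · exact hAl _ (by simp)
        · exact hAl _ (by simp)
      exact Finset.mem_erase.2 ⟨fun e => hcA (e ▸ hcD),
        hc.mem_offNodes_of_ne_zero hA hcA hAi⟩) (by
      rw [Finset.card_erase_of_mem (mem_offNodes.2 ⟨hD, hDi, hDl⟩), hl.card_off]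
      simp)
  have h2 := hc.1.eq_zero_off_lines [L k] (by simp [h.line]) (offNodes X (L j) l) (by
      intro A hA hcA hAl
      refine hc.mem_offNodes_of_ne_zero hA hcA ?_
      by_contra hAj
      exact hcA (h1 A hA (by simpa [hAj] using hAl))) (by simp [hl.card_off])
  have h3 := hc.1.eq_zero_off_lines [] (by simp) (offNodes X (L k) l) (by
      intro A hA hcA _
      refine hc.mem_offNodes_of_ne_zero hA hcA ?_
      by_contra hAk
      exact hcA (h2 A hA (by simpa using hAk))) (by simp [hl.card_off])
  exact fun A hA => h3 A hA (by simp)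

theorem Config.rel_M₃_eq_zero (h : Config X L t₁ t₂ t₃ B₁ B₂ B₃ M₁ M₂ M₃)
    {c : ℝ × ℝ → ℝ} (hc : IsRel X 4 c) (hcB : c B₁ = 0) (hcM : c M₂ = 0) : c M₃ = 0 := by
  obtain ⟨hX, hL⟩ := h.mem_off (A := M₃) (by simp)
  refine hc.eq_zero_off_lines [L 0, L 1, L 2, t₁] (by simp [h.line, h.line₁]) {M₃} ?_ (by simp)
    M₃ hX (by simp [hL, h.off₁.2.2])
  intro A hA hcA hAl
  simp only [List.mem_cons, List.not_mem_nil, or_false, forall_eq_or_imp, forall_eq] at hAl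
  obtain ⟨h0, h1, h2, h3⟩ := hAl
  rcases h.off_iff_of_indices (i := 0) (j := 1) (k := 2) (by decide) hA h0 h1 h2 with
    rfl | rfl | rfl | rfl | rfl | rfl
  · exact absurd hcB hcA
  · exact absurd h.on₁.1 h3
  · exact absurd h.on₁.2.1 h3
  · exact absurd h.on₁.2.2 h3
  · exact absurd hcM hcA
  · simp

/-- A dependency off `l` vanishing at `M₂`, at another node of `t₁` and at a node of some `L i`
is trivial. -/
theorem Config.rel_eq_zero_of_t₁ (h : Config X L t₁ t₂ t₃ B₁ B₂ B₃ M₁ M₂ M₃)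
    (hl : SimpleLine X L B₁ B₂ B₃ M₁ M₂ M₃ l) {c : ℝ × ℝ → ℝ} (hc : LineRel X l c)
    (hcM : c M₂ = 0) {P : ℝ × ℝ} (hP : P = B₂ ∨ P = B₃ ∨ P = M₁) (hcP : c P = 0)
    {D : ℝ × ℝ} (hD : D ∈ X) (hDl : ev l D ≠ 0) (hcD : c D = 0) {i : Fin 3}
    (hDi : ev (L i) D = 0) : ∀ A ∈ X, c A = 0 := by
  classical
  have hcB : c B₁ = 0 := hc.2 _ (h.mem_off (by simp)).1 hl.on
  have hcM3 := h.rel_M₃_eq_zero hc.1 hcB hcM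
  refine h.rel_eq_zero hl hc (fun A hA hAL => ?_) hD hDl hcD hDi
  refine hc.1.eq_zero_off_lines [L 0, L 1, L 2] (by simp [h.line])
    (({B₂, B₃, M₁} : Finset (ℝ × ℝ)).erase P) ?_ ?_ A hA (by simp [hAL])
  · intro A hA hcA hAl
    simp only [List.mem_cons, List.not_mem_nil, or_false, forall_eq_or_imp, forall_eq] at hAl
    obtain ⟨h0, h1, h2⟩ := hAl
    refine Finset.mem_erase.2 ⟨fun e => hcA (e ▸ hcP), ?_⟩
    rcases h.off_iff_of_indices (i := 0) (j := 1) (k := 2) (by decide) hA h0 h1 h2 with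
      rfl | rfl | rfl | rfl | rfl | rfl
    · exact absurd hcB hcA
    · simp
    · simp
    · simp
    · exact absurd hcM hcA
    · exact absurd hcM3 hcA
  · rw [Finset.card_erase_of_mem (by simpa using hP)]
    have : ({B₂, B₃, M₁} : Finset (ℝ × ℝ)).card ≤ 3 := Finset.card_le_three
    simp only [List.length_cons, List.length_nil]
    omega

/-- A dependency off `l` vanishing at `M₂` is trivial if its support has at most two points on
one of the lines `L i` and at most three on a second one. -/
theorem Config.rel_eq_zero_of_few (h : Config X L t₁ t₂ t₃ B₁ B₂ B₃ M₁ M₂ M₃)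
    (hl : SimpleLine X L B₁ B₂ B₃ M₁ M₂ M₃ l) {c : ℝ × ℝ → ℝ} (hc : LineRel X l c)
    (hcM : c M₂ = 0) {i j : Fin 3} (hij : i ≠ j) {S T : Finset (ℝ × ℝ)}
    (hS : ∀ A ∈ X, c A ≠ 0 → ev (L i) A = 0 → A ∈ S) (hS2 : S.card ≤ 2)
    (hT : ∀ A ∈ X, c A ≠ 0 → ev (L j) A = 0 → A ∈ T) (hT3 : T.card ≤ 3) :
    ∀ A ∈ X, c A = 0 := by
  have hcB : c B₁ = 0 := hc.2 _ (h.mem_off (by simp)).1 hl.on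
  have hcM3 := h.rel_M₃_eq_zero hc.1 hcB hcM
  obtain ⟨k, hx⟩ := exists_third_index hij
  have h1 := hc.1.eq_zero_off_lines [t₁, L j, L k] (by simp [h.line, h.line₁]) S (by
      intro A hA hcA hAl
      simp only [List.mem_cons, List.not_mem_nil, or_false, forall_eq_or_imp, forall_eq] at hAl
      obtain ⟨h1, hj, hk⟩ := hAl
      refine hS A hA hcA ?_
      by_contra hi
      rcases h.off_iff_of_indices hx hA hi hj hk with rfl | rfl | rfl | rfl | rfl | rfl
      · exact hcA hcB
      · exact h1 h.on₁.1
      · exact h1 h.on₁.2.1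
      · exact h1 h.on₁.2.2
      · exact hcA hcM
      · exact hcA hcM3) (by simpa using hS2)
  have h2 := hc.1.eq_zero_off_lines [t₁, L k] (by simp [h.line, h.line₁]) T (by
      intro A hA hcA hAl
      simp only [List.mem_cons, List.not_mem_nil, or_false, forall_eq_or_imp, forall_eq] at hAl
      refine hT A hA hcA ?_
      by_contra hj
      exact hcA (h1 A hA (by simp [hAl, hj]))) (by simpa using hT3)
  have h3 := hc.1.eq_zero_off_lines [t₁] (by simp [h.line₁]) (offNodes X (L k) l) (by
      intro A hA hcA hAl
      refine hc.mem_offNodes_of_ne_zero hA hcA ?_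
      by_contra hk
      exact hcA (h2 A hA (by simpa [hk] using hAl))) (by simp [hl.card_off])
  have h4 := hc.1.eq_zero_off_lines [] (by simp) (nodes X t₁) (by
      intro A hA hcA _
      refine mem_nodes.2 ⟨hA, ?_⟩
      by_contra h0
      exact hcA (h3 A hA (by simpa using h0))) (by simpa using h.card_nodes_le _ h.line₁)
  exact fun A hA => h4 A hA (by simp)

theorem mem_erase_of_apply_ne_zero {c : ℝ × ℝ → ℝ} {D A : ℝ × ℝ} (hcD : c D = 0)
    (hcA : c A ≠ 0) {S : Finset (ℝ × ℝ)} (hA : A ∈ S) : A ∈ S.erase D :=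
  Finset.mem_erase.2 ⟨fun e => hcA (e ▸ hcD), hA⟩

theorem relSupport_not_nonempty_of_zero {c : ℝ × ℝ → ℝ} (h : ∀ A ∈ X, c A = 0) :
    ¬ (relSupport X c).Nonempty := by
  rintro ⟨A, hA⟩
  exact (mem_relSupport.1 hA).2 (h A (mem_relSupport.1 hA).1)

/-- Of three nodes on the lines `L i` using `l`, no two are on the same line `L i`. -/
theorem Config.users_not_on_same (h : Config X L t₁ t₂ t₃ B₁ B₂ B₃ M₁ M₂ M₃)
    (hl : SimpleLine X L B₁ B₂ B₃ M₁ M₂ M₃ l) {D D' D'' : ℝ × ℝ} (hD : D ∈ X) (hD' : D' ∈ X)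
    (hD'' : D'' ∈ X) (hne : D ≠ D') (hne' : D ≠ D'') (hne'' : D' ≠ D'')
    (hu : Uses 5 (X : Set (ℝ × ℝ)) D l) (hu' : Uses 5 (X : Set (ℝ × ℝ)) D' l)
    (hu'' : Uses 5 (X : Set (ℝ × ℝ)) D'' l) {i j : Fin 3} (hi : ev (L i) D = 0)
    (hi' : ev (L i) D' = 0) (hj : ev (L j) D'' = 0) : False := by
  classical
  have hDl := (Uses.exists_lines h.gc hl.line hD hu).1
  have hDl' := (Uses.exists_lines h.gc hl.line hD' hu').1
  have hDl'' := (Uses.exists_lines h.gc hl.line hD'' hu'').1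
  have hmem : D ∈ offNodes X (L i) l := mem_offNodes.2 ⟨hD, hi, hDl⟩
  have hmem' : D' ∈ (offNodes X (L i) l).erase D :=
    Finset.mem_erase.2 ⟨hne.symm, mem_offNodes.2 ⟨hD', hi', hDl'⟩⟩
  have hcard : (((offNodes X (L i) l).erase D).erase D').card = 2 := by
    rw [Finset.card_erase_of_mem hmem', Finset.card_erase_of_mem hmem, hl.card_off]
  by_cases hij : i = j
  · subst hij
    have hmem'' : D'' ∈ ((offNodes X (L i) l).erase D).erase D' :=
      Finset.mem_erase.2 ⟨hne''.symm, Finset.mem_erase.2 ⟨hne'.symm,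
        mem_offNodes.2 ⟨hD'', hj, hDl''⟩⟩⟩
    obtain ⟨E, hE⟩ : ∃ E, (((offNodes X (L i) l).erase D).erase D').erase D'' = {E} :=
      Finset.card_eq_one.1 (by rw [Finset.card_erase_of_mem hmem'', hcard])
    obtain ⟨c, hc, hne0, hcE⟩ := h.exists_rel_zero_at hl E
    refine relSupport_not_nonempty_of_zero ?_ hne0
    have hcB : c B₁ = 0 := hc.2 _ (h.mem_off (by simp)).1 hl.on
    have hci : ∀ A ∈ X, ev (L i) A = 0 → c A = 0 := by
      intro A hA hAi
      by_contra hcA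
      have hm := mem_erase_of_apply_ne_zero (hc.eq_zero_of_uses hl.line hD'' hu'') hcA <|
        mem_erase_of_apply_ne_zero (hc.eq_zero_of_uses hl.line hD' hu') hcA <|
        mem_erase_of_apply_ne_zero (hc.eq_zero_of_uses hl.line hD hu) hcA <|
        hc.mem_offNodes_of_ne_zero hA hcA hAi
      rw [hE, Finset.mem_singleton] at hm
      exact hcA (hm ▸ hcE)
    obtain ⟨j, k, -, -, -, hx⟩ := exists_other_indices i
    have h1 := hc.1.eq_zero_off_lines [t₁, L j, L k] (by simp [h.line, h.line₁]) {M₂, M₃} (by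
      intro A hA hcA hAl
      simp only [List.mem_cons, List.not_mem_nil, or_false, forall_eq_or_imp, forall_eq] at hAl
      obtain ⟨h1, hj, hk⟩ := hAl
      rcases h.off_iff_of_indices hx hA (fun h0 => hcA (hci A hA h0)) hj hk with
        rfl | rfl | rfl | rfl | rfl | rfl
      · exact absurd hcB hcA
      · exact absurd h.on₁.1 h1
      · exact absurd h.on₁.2.1 h1
      · exact absurd h.on₁.2.2 h1
      · simp
      · simp) (by
        have : ({M₂, M₃} : Finset (ℝ × ℝ)).card ≤ 2 := Finset.card_le_two
        simpa using this)
    have h2 := hc.1.eq_zero_off_lines [L j, L k] (by simp [h.line]) {B₂, B₃, M₁} (by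
      intro A hA hcA hAl
      simp only [List.mem_cons, List.not_mem_nil, or_false, forall_eq_or_imp, forall_eq] at hAl
      obtain ⟨hj, hk⟩ := hAl
      rcases h.off_iff_of_indices hx hA (fun h0 => hcA (hci A hA h0)) hj hk with
        rfl | rfl | rfl | rfl | rfl | rfl
      · exact absurd hcB hcA
      · simp
      · simp
      · simp
      · exact absurd (h1 _ hA (by simp [hj, hk, h.off₁.2.1])) hcA
      · exact absurd (h1 _ hA (by simp [hj, hk, h.off₁.2.2])) hcA) (by
        have : ({B₂, B₃, M₁} : Finset (ℝ × ℝ)).card ≤ 3 := Finset.card_le_three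
        simpa using this)
    exact h.rel_eq_zero hl hc (fun A hA hAL => h2 A hA (by simp [hAL])) hD hDl
      (hc.eq_zero_of_uses hl.line hD hu) hi
  · obtain ⟨c, hc, hne0, hcM⟩ := h.exists_rel_zero_at hl M₂
    refine relSupport_not_nonempty_of_zero ?_ hne0
    exact h.rel_eq_zero_of_few hl hc hcM hij
      (fun A hA hcA hAi =>
        mem_erase_of_apply_ne_zero (hc.eq_zero_of_uses hl.line hD' hu') hcA <|
        mem_erase_of_apply_ne_zero (hc.eq_zero_of_uses hl.line hD hu) hcA <|
        hc.mem_offNodes_of_ne_zero hA hcA hAi) hcard.le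
      (fun A hA hcA hAj =>
        mem_erase_of_apply_ne_zero (hc.eq_zero_of_uses hl.line hD'' hu'') hcA <|
        hc.mem_offNodes_of_ne_zero hA hcA hAj)
      (by rw [Finset.card_erase_of_mem (mem_offNodes.2 ⟨hD'', hj, hDl''⟩), hl.card_off])

theorem SimpleLine.swap (hl : SimpleLine X L B₁ B₂ B₃ M₁ M₂ M₃ l) :
    SimpleLine X L B₁ B₃ B₂ M₁ M₃ M₂ l where
  line := hl.line
  card := hl.card
  on := hl.on
  offB₂ := hl.offB₃
  offB₃ := hl.offB₂
  offM₁ := hl.offM₁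
  offM₂ := hl.offM₃
  offM₃ := hl.offM₂
  card_off := hl.card_off

variable {D : Fin 3 → ℝ × ℝ}

/-- The nodes off the line `l` other than the three nodes `D i`. -/
noncomputable def freeNodes (X : Finset (ℝ × ℝ)) (l : MvPolynomial (Fin 2) ℝ)
    (D : Fin 3 → ℝ × ℝ) : Finset (ℝ × ℝ) :=
  X.filter fun A => ev l A ≠ 0 ∧ ∀ i, A ≠ D i

theorem mem_freeNodes {A : ℝ × ℝ} :
    A ∈ freeNodes X l D ↔ A ∈ X ∧ ev l A ≠ 0 ∧ ∀ i, A ≠ D i := by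
  simp [freeNodes]

/-- A line `l` used by one node on each of the lines `L i`. -/
structure UserTriple (X : Finset (ℝ × ℝ)) (L : Fin 3 → MvPolynomial (Fin 2) ℝ)
    (l : MvPolynomial (Fin 2) ℝ) (D : Fin 3 → ℝ × ℝ) : Prop where
  mem : ∀ i, D i ∈ X
  on : ∀ i, ev (L i) (D i) = 0
  uses : ∀ i, Uses 5 (X : Set (ℝ × ℝ)) (D i) l
  off : ∀ i, ev l (D i) ≠ 0

theorem UserTriple.rel_eq_zero (hD : UserTriple X L l D) (hl : IsLinePoly l) {c : ℝ × ℝ → ℝ}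
    (hc : LineRel X l c) (i : Fin 3) : c (D i) = 0 :=
  hc.eq_zero_of_uses hl (hD.mem i) (hD.uses i)

theorem UserTriple.mem_freeNodes_of_ne_zero (hD : UserTriple X L l D) (hl : IsLinePoly l)
    {c : ℝ × ℝ → ℝ} (hc : LineRel X l c) {A : ℝ × ℝ} (hA : A ∈ X) (hcA : c A ≠ 0) :
    A ∈ freeNodes X l D :=
  mem_freeNodes.2 ⟨hA, fun h0 => hcA (hc.2 A hA h0),
    fun i e => hcA (e ▸ hD.rel_eq_zero hl hc i)⟩

theorem Config.card_freeNodes (h : Config X L t₁ t₂ t₃ B₁ B₂ B₃ M₁ M₂ M₃)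
    (hl : SimpleLine X L B₁ B₂ B₃ M₁ M₂ M₃ l) (hD : UserTriple X L l D) :
    (freeNodes X l D).card = 14 := by
  classical
  have hinj : Function.Injective D := by
    intro i j hij
    by_contra hne
    exact h.disj i j hne (D i) (hD.mem i) (hD.on i) (hij ▸ hD.on j)
  have heq : freeNodes X l D = (X \ nodes X l) \ Finset.univ.image D := by
    ext A
    simp only [mem_freeNodes, Finset.mem_sdiff, mem_nodes, Finset.mem_image, Finset.mem_univ,
      true_and, not_exists]
    tauto
  rw [heq, Finset.card_sdiff_of_subset, Finset.card_sdiff_of_subset, h.card, hl.card,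
    Finset.card_image_of_injective _ hinj]
  · simp
  · exact Finset.filter_subset _ _
  · intro A hA
    obtain ⟨i, -, rfl⟩ := Finset.mem_image.1 hA
    exact Finset.mem_sdiff.2 ⟨hD.mem i, fun h0 => hD.off i (mem_nodes.1 h0).2⟩

theorem Config.mem_freeNodes_of_off (h : Config X L t₁ t₂ t₃ B₁ B₂ B₃ M₁ M₂ M₃)
    (hD : UserTriple X L l D) {A : ℝ × ℝ}
    (hA : A = B₁ ∨ A = B₂ ∨ A = B₃ ∨ A = M₁ ∨ A = M₂ ∨ A = M₃) (hAl : ev l A ≠ 0) :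
    A ∈ freeNodes X l D :=
  mem_freeNodes.2 ⟨(h.mem_off hA).1, hAl, fun i e => (h.mem_off hA).2 i (e ▸ hD.on i)⟩

/-- Every node off `l` other than the `D i` is in the support of a dependency off `l`. -/
theorem Config.exists_rel_ne_zero_at (h : Config X L t₁ t₂ t₃ B₁ B₂ B₃ M₁ M₂ M₃)
    (hl : SimpleLine X L B₁ B₂ B₃ M₁ M₂ M₃ l) (hD : UserTriple X L l D) {A : ℝ × ℝ}
    (hA : A ∈ freeNodes X l D) : ∃ c, LineRel X l c ∧ c A ≠ 0 := by
  classical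
  obtain ⟨hAX, hAl, hAD⟩ := mem_freeNodes.1 hA
  have hB : ∀ {c}, LineRel X l c → c B₁ = 0 := fun hc => hc.2 _ (h.mem_off (by simp)).1 hl.on
  have hzero : ∀ {c}, LineRel X l c → c M₂ = 0 → ∀ {P}, (P = B₂ ∨ P = B₃ ∨ P = M₁) → c P = 0 →
      ¬ (relSupport X c).Nonempty := fun {c} hc hcM {P} hP hcP =>
    relSupport_not_nonempty_of_zero (h.rel_eq_zero_of_t₁ hl hc hcM hP hcP (hD.mem 0) (hD.off 0)
      (hD.rel_eq_zero hl.line hc 0) (hD.on 0))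
  obtain ⟨c, hc, hne, hcM⟩ := h.exists_rel_zero_at hl M₂
  obtain ⟨d, hd, hdne, hdM⟩ := h.exists_rel_zero_at hl M₁
  by_cases hAL : ∀ i, ev (L i) A ≠ 0
  · rcases (h.off_iff A).1 ⟨hAX, hAL⟩ with e | e | e | e | e | e
    · exact absurd (e ▸ hl.on) hAl
    · exact ⟨c, hc, fun h0 => hzero hc hcM (Or.inl e) h0 hne⟩
    · exact ⟨c, hc, fun h0 => hzero hc hcM (Or.inr (Or.inl e)) h0 hne⟩
    · exact ⟨c, hc, fun h0 => hzero hc hcM (Or.inr (Or.inr e)) h0 hne⟩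
    · exact ⟨d, hd, fun h0 => hzero hd (e ▸ h0) (Or.inr (Or.inr rfl)) hdM hdne⟩
    · exact ⟨d, hd, fun h0 => hzero hd (h.swap.rel_M₃_eq_zero hd.1 (hB hd) (e ▸ h0))
        (Or.inr (Or.inr rfl)) hdM hdne⟩
  · push Not at hAL
    obtain ⟨i, hi⟩ := hAL
    refine ⟨c, hc, fun h0 => relSupport_not_nonempty_of_zero ?_ hne⟩
    obtain ⟨j, -, hij, -, -, -⟩ := exists_other_indices i
    have hmem : ∀ x, D x ∈ offNodes X (L x) l := fun x =>
      mem_offNodes.2 ⟨hD.mem x, hD.on x, hD.off x⟩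
    have hmemA : A ∈ (offNodes X (L i) l).erase (D i) :=
      Finset.mem_erase.2 ⟨hAD i, mem_offNodes.2 ⟨hAX, hi, hAl⟩⟩
    refine h.rel_eq_zero_of_few hl hc hcM hij
      (S := ((offNodes X (L i) l).erase (D i)).erase A) (T := (offNodes X (L j) l).erase (D j))
      (fun P hP hcP hPi => mem_erase_of_apply_ne_zero h0 hcP <|
        mem_erase_of_apply_ne_zero (hD.rel_eq_zero hl.line hc i) hcP <|
        hc.mem_offNodes_of_ne_zero hP hcP hPi) ?_
      (fun P hP hcP hPj => mem_erase_of_apply_ne_zero (hD.rel_eq_zero hl.line hc j) hcP <|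
        hc.mem_offNodes_of_ne_zero hP hcP hPj) ?_
    · rw [Finset.card_erase_of_mem hmemA, Finset.card_erase_of_mem (hmem i), hl.card_off]
    · rw [Finset.card_erase_of_mem (hmem j), hl.card_off]

/-- If four lines cover the free nodes then three of them do. -/
theorem Config.exists_redundant (h : Config X L t₁ t₂ t₃ B₁ B₂ B₃ M₁ M₂ M₃)
    (hl : SimpleLine X L B₁ B₂ B₃ M₁ M₂ M₃ l) (hD : UserTriple X L l D)
    (m : Fin 4 → MvPolynomial (Fin 2) ℝ) (hm : ∀ i, IsLinePoly (m i))
    (hcov : ∀ A ∈ freeNodes X l D, ∃ i, ev (m i) A = 0) :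
    ∃ i, ∀ A ∈ freeNodes X l D, ∃ j ∈ Finset.univ.erase i, ev (m j) A = 0 := by
  classical
  by_contra hcon
  push Not at hcon
  obtain ⟨P, hP⟩ : ∃ P : Fin 4 → Finset (ℝ × ℝ), ∀ {i A}, A ∈ P i ↔
      A ∈ freeNodes X l D ∧ ∀ j ∈ Finset.univ.erase i, ev (m j) A ≠ 0 :=
    ⟨fun i => (freeNodes X l D).filter fun A => ∀ j ∈ Finset.univ.erase i, ev (m j) A ≠ 0,
      Finset.mem_filter⟩
  have hPsub : ∀ i, P i ⊆ freeNodes X l D := fun i A hA => (hP.1 hA).1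
  have hPon : ∀ {i A}, A ∈ P i → ev (m i) A = 0 := by
    intro i A hA
    obtain ⟨hAW, hA⟩ := hP.1 hA
    obtain ⟨j, hj⟩ := hcov A hAW
    by_cases hji : j = i
    · exact hji ▸ hj
    · exact absurd hj (hA j (by simp [hji]))
  have hPdisj : ∀ {i j}, i ≠ j → Disjoint (P i) (P j) := fun {i j} hij =>
    Finset.disjoint_left.2 fun A hAi hAj => (hP.1 hAj).2 i (by simp [hij]) (hPon hAi)
  have hpeel : ∀ {c}, LineRel X l c → ∀ i, ∀ S ⊆ P i, S.card ≤ 2 →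
      (∀ A ∈ P i, c A ≠ 0 → A ∈ S) → ∀ A ∈ P i, c A = 0 := by
    intro c hc i S hS hS2 hSc A hA
    have hmem : ∀ q ∈ (Finset.univ.erase i).toList.map m, ∃ j ∈ Finset.univ.erase i, m j = q := by
      intro q hq
      obtain ⟨j, hj, rfl⟩ := List.mem_map.1 hq
      exact ⟨j, Finset.mem_toList.1 hj, rfl⟩
    refine hc.1.eq_zero_off_lines ((Finset.univ.erase i).toList.map m) ?_ S ?_ ?_ A
      (mem_freeNodes.1 (hP.1 hA).1).1 ?_
    · intro q hq
      obtain ⟨j, -, rfl⟩ := hmem q hq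
      exact hm j
    · intro B hB hcB hBl
      refine hSc B (hP.2 ⟨hD.mem_freeNodes_of_ne_zero hl.line hc hB hcB, fun j hj => ?_⟩) hcB
      exact hBl _ (List.mem_map.2 ⟨j, Finset.mem_toList.2 hj, rfl⟩)
    · rw [List.length_map, Finset.length_toList, Finset.card_erase_of_mem (Finset.mem_univ i),
        Finset.card_univ, Fintype.card_fin]
      omega
    · intro q hq
      obtain ⟨j, hj, rfl⟩ := hmem q hq
      exact (hP.1 hA).2 j hj
  have hP3 : ∀ i, 3 ≤ (P i).card := by
    intro i
    by_contra hlt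
    obtain ⟨A, hA, hAm⟩ := hcon i
    obtain ⟨c, hc, hcA⟩ := h.exists_rel_ne_zero_at hl hD hA
    exact hcA (hpeel hc i (P i) subset_rfl (by omega) (fun B hB _ => hB) A (hP.2 ⟨hA, hAm⟩))
  have hW := h.card_freeNodes hl hD
  obtain ⟨i, hi⟩ : ∃ i, (P i).card ≤ 3 := by
    by_contra hall
    push Not at hall
    have hsum : (Finset.univ.biUnion P).card = ∑ i, (P i).card :=
      Finset.card_biUnion fun i _ j _ hij => hPdisj hij
    have hle := Finset.card_le_card (Finset.biUnion_subset.2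
      fun i (_ : i ∈ Finset.univ) => hPsub i)
    have hge := Finset.card_nsmul_le_sum Finset.univ (fun i => (P i).card) 4 fun i _ => hall i
    simp only [Finset.card_univ, Fintype.card_fin, smul_eq_mul] at hge
    omega
  obtain ⟨A, hA⟩ : (P i).Nonempty := Finset.card_pos.1 (by have := hP3 i; omega)
  obtain ⟨c, hc, hne, hcA⟩ := h.exists_rel_zero_at hl A
  have hcP := hpeel hc i ((P i).erase A) (Finset.erase_subset _ _)
    (by rw [Finset.card_erase_of_mem hA]; omega)
    (fun B hB hcB => mem_erase_of_apply_ne_zero hcA hcB hB)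
  have hsub : relSupport X c ⊆ freeNodes X l D \ P i := by
    intro B hB
    obtain ⟨hBX, hcB⟩ := mem_relSupport.1 hB
    exact Finset.mem_sdiff.2 ⟨hD.mem_freeNodes_of_ne_zero hl.line hc hBX hcB,
      fun hBP => hcB (hcP B hBP)⟩
  have hsubcard := Finset.card_le_card hsub
  rw [Finset.card_sdiff_of_subset (hPsub i), hW] at hsubcard
  have hPi := hP3 i
  obtain ⟨j, hj, k, hk, hjk, -, hj5, hk5⟩ := hc.1.exists_two_lines hne m hm
    (fun x => h.card_nodes_le _ (hm x)) (by omega) (Finset.univ.erase i) (by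
      intro B hB
      obtain ⟨hBW, hBP⟩ := Finset.mem_sdiff.1 (hsub hB)
      by_contra hno
      push Not at hno
      exact hBP (hP.2 ⟨hBW, hno⟩))
  obtain ⟨x, hxi, hxj, hxk⟩ : ∃ x : Fin 4, x ≠ i ∧ x ≠ j ∧ x ≠ k := by
    clear * -
    revert i j k
    decide
  have hij : i ≠ j := (Finset.ne_of_mem_erase hj).symm
  have hik : i ≠ k := (Finset.ne_of_mem_erase hk).symm
  set Qj := (relSupport X c).filter fun A => ev (m j) A = 0 ∧ ev (m k) A ≠ 0 with hQj
  set Qk := (relSupport X c).filter fun A => ev (m k) A = 0 ∧ ev (m j) A ≠ 0 with hQk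
  have hQ : Disjoint Qj Qk := Finset.disjoint_left.2 fun B h1 h2 =>
    (Finset.mem_filter.1 h2).2.2 (Finset.mem_filter.1 h1).2.1
  have hPQ : Disjoint (P i ∪ P x) (Qj ∪ Qk) := by
    refine Finset.disjoint_left.2 fun B hB hBQ => ?_
    have hoff : ev (m j) B ≠ 0 ∧ ev (m k) B ≠ 0 := by
      rcases Finset.mem_union.1 hB with hB | hB
      · exact ⟨(hP.1 hB).2 j hj, (hP.1 hB).2 k hk⟩
      · exact ⟨(hP.1 hB).2 j (by simp [hxj.symm]), (hP.1 hB).2 k (by simp [hxk.symm])⟩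
    rcases Finset.mem_union.1 hBQ with hBQ | hBQ
    · exact hoff.1 (Finset.mem_filter.1 hBQ).2.1
    · exact hoff.2 (Finset.mem_filter.1 hBQ).2.1
  have htot := Finset.card_le_card (show (P i ∪ P x) ∪ (Qj ∪ Qk) ⊆ freeNodes X l D from
    Finset.union_subset (Finset.union_subset (hPsub i) (hPsub x))
      (Finset.union_subset
        ((Finset.filter_subset _ _).trans (hsub.trans Finset.sdiff_subset))
        ((Finset.filter_subset _ _).trans (hsub.trans Finset.sdiff_subset))))
  rw [Finset.card_union_of_disjoint hPQ, Finset.card_union_of_disjoint (hPdisj hxi.symm),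
    Finset.card_union_of_disjoint hQ] at htot
  have hPx := hP3 x
  omega

/-- Three lines which cover the free nodes and miss a node `D a` contain none of the `L i`. -/
theorem Config.not_dvd_of_cover (h : Config X L t₁ t₂ t₃ B₁ B₂ B₃ M₁ M₂ M₃)
    (hl : SimpleLine X L B₁ B₂ B₃ M₁ M₂ M₃ l) (hD : UserTriple X L l D)
    (m : Fin 4 → MvPolynomial (Fin 2) ℝ) (hm : ∀ i, IsLinePoly (m i)) {a : Fin 3}
    (hmD : ∀ i, ev (m i) (D a) ≠ 0) {J : Finset (Fin 4)} (hJ : J.card = 3)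
    (hcov : ∀ A ∈ freeNodes X l D, ∃ j ∈ J, ev (m j) A = 0) (x : Fin 3) {j : Fin 4}
    (hj : j ∈ J) : ¬ L x ∣ m j := by
  classical
  intro hxj
  by_cases hxa : x = a
  · exact hmD j (ev_eq_zero_of_dvd hxj (hxa ▸ hD.on a))
  have hcard : ∀ z, ((offNodes X (L z) l).erase (D z)).card = 3 := fun z => by
    rw [Finset.card_erase_of_mem (mem_offNodes.2 ⟨hD.mem z, hD.on z, hD.off z⟩), hl.card_off]
  have hfree : ∀ z, ∀ A ∈ (offNodes X (L z) l).erase (D z),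
      A ∈ freeNodes X l D ∧ A ∈ X ∧ ev (L z) A = 0 := by
    intro z A hA
    obtain ⟨hAD, hA⟩ := Finset.mem_erase.1 hA
    obtain ⟨hAX, hAz, hAl⟩ := mem_offNodes.1 hA
    refine ⟨mem_freeNodes.2 ⟨hAX, hAl, fun w e => ?_⟩, hAX, hAz⟩
    by_cases hwz : w = z
    · exact hAD (hwz ▸ e)
    · exact h.disj w z hwz (D w) (hD.mem w) (hD.on w) (e ▸ hAz)
  have hoff : ∀ z w i, z ≠ w → L w ∣ m i → ∀ A ∈ (offNodes X (L z) l).erase (D z),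
      ev (m i) A ≠ 0 := by
    intro z w i hzw hd A hA
    obtain ⟨-, hAX, hAz⟩ := hfree z A hA
    exact ev_ne_zero_of_dvd (h.line w) (hm i) hd (h.disj z w hzw A hAX hAz)
  obtain ⟨y, hya, hyx⟩ : ∃ y : Fin 3, y ≠ a ∧ y ≠ x := by
    clear * -
    revert a x
    decide
  obtain ⟨k, hk, hyk⟩ := exists_dvd_of_cover (h.line y) (J.erase j) m hm
    ((offNodes X (L y) l).erase (D y)) (fun A hA => (hfree y A hA).2.2) (by
      intro A hA
      obtain ⟨k, hk, hkA⟩ := hcov A (hfree y A hA).1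
      exact ⟨k, Finset.mem_erase.2 ⟨fun e => hoff y x j hyx hxj A hA (e ▸ hkA), hk⟩, hkA⟩) (by
      rw [Finset.card_erase_of_mem hj, hcard, hJ]
      omega)
  obtain ⟨n, -, han⟩ := exists_dvd_of_cover (h.line a) ((J.erase j).erase k) m hm
    ((offNodes X (L a) l).erase (D a)) (fun A hA => (hfree a A hA).2.2) (by
      intro A hA
      obtain ⟨n, hn, hnA⟩ := hcov A (hfree a A hA).1
      exact ⟨n, Finset.mem_erase.2 ⟨fun e => hoff a y k hya.symm hyk A hA (e ▸ hnA),
        Finset.mem_erase.2 ⟨fun e => hoff a x j (Ne.symm hxa) hxj A hA (e ▸ hnA), hn⟩⟩, hnA⟩) (by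
      rw [Finset.card_erase_of_mem hk, Finset.card_erase_of_mem hj, hcard, hJ]
      omega)
  exact hmD n (ev_eq_zero_of_dvd han (hD.on a))

/-- Of three lines which cover the free nodes and miss a node `D a`, one joins `B₂` with `M₂` or
`B₃` with `M₃`. -/
theorem Config.exists_median_of_cover (h : Config X L t₁ t₂ t₃ B₁ B₂ B₃ M₁ M₂ M₃)
    (hl : SimpleLine X L B₁ B₂ B₃ M₁ M₂ M₃ l) (hD : UserTriple X L l D)
    (m : Fin 4 → MvPolynomial (Fin 2) ℝ) (hm : ∀ i, IsLinePoly (m i)) {a : Fin 3}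
    (hmD : ∀ i, ev (m i) (D a) ≠ 0) {J : Finset (Fin 4)} (hJ : J.card = 3)
    (hcov : ∀ A ∈ freeNodes X l D, ∃ j ∈ J, ev (m j) A = 0) :
    ∃ j, (ev (m j) B₂ = 0 ∧ ev (m j) M₂ = 0) ∨ (ev (m j) B₃ = 0 ∧ ev (m j) M₃ = 0) := by
  classical
  have hpts : ∀ j ∈ J, ∀ x, ∃ A ∈ X, ev (L x) A = 0 ∧ ev (m j) A = 0 := by
    intro j hj x
    have hcard : ((offNodes X (L x) l).erase (D x)).card = 3 := by
      rw [Finset.card_erase_of_mem (mem_offNodes.2 ⟨hD.mem x, hD.on x, hD.off x⟩), hl.card_off]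
    obtain ⟨A, hA, hjA⟩ := forall_exists_of_cover (h.line x) J m hm
      ((offNodes X (L x) l).erase (D x))
      (fun A hA => (mem_offNodes.1 (Finset.mem_of_mem_erase hA)).2.1) (by
        intro A hA
        obtain ⟨hAD, hA⟩ := Finset.mem_erase.1 hA
        obtain ⟨hAX, hAx, hAl⟩ := mem_offNodes.1 hA
        refine hcov A (mem_freeNodes.2 ⟨hAX, hAl, fun w e => ?_⟩)
        by_cases hwx : w = x
        · exact hAD (hwx ▸ e)
        · exact h.disj w x hwx (D w) (hD.mem w) (hD.on w) (e ▸ hAx)) (by omega)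
      (fun i hi => h.not_dvd_of_cover hl hD m hm hmD hJ hcov x hi) j hj
    have hA' := mem_offNodes.1 (Finset.mem_of_mem_erase hA)
    exact ⟨A, hA'.1, hA'.2.1, hjA⟩
  have htwo : ∀ j ∈ J, ∀ S : Finset (ℝ × ℝ), S.card = 3 →
      (∀ A ∈ S, A = B₁ ∨ A = B₂ ∨ A = B₃ ∨ A = M₁ ∨ A = M₂ ∨ A = M₃) →
      ¬ ∀ A ∈ S, ev (m j) A = 0 := by
    intro j hj S hS hSoff hSj
    choose E hEX hEL hEm using hpts j hj
    have hinj : Function.Injective E := by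
      intro x y hxy
      by_contra hne
      exact h.disj x y hne (E x) (hEX x) (hEL x) (hxy ▸ hEL y)
    have hdisj : Disjoint S (Finset.univ.image E) := by
      refine Finset.disjoint_left.2 fun A hA hA' => ?_
      obtain ⟨x, -, rfl⟩ := Finset.mem_image.1 hA'
      exact (h.mem_off (hSoff _ hA)).2 x (hEL x)
    have hsub : S ∪ Finset.univ.image E ⊆ nodes X (m j) := by
      intro A hA
      rcases Finset.mem_union.1 hA with hA | hA
      · exact mem_nodes.2 ⟨(h.mem_off (hSoff _ hA)).1, hSj A hA⟩
      · obtain ⟨x, -, rfl⟩ := Finset.mem_image.1 hA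
        exact mem_nodes.2 ⟨hEX x, hEm x⟩
    have hle := Finset.card_le_card hsub
    rw [Finset.card_union_of_disjoint hdisj, Finset.card_image_of_injective _ hinj, hS,
      Finset.card_univ, Fintype.card_fin] at hle
    have := h.card_nodes_le _ (hm j)
    omega
  have hB12 : B₁ ≠ B₂ := fun e => h.off₁.1 (e ▸ h.on₁.1)
  have hB13 : B₁ ≠ B₃ := fun e => h.off₁.1 (e ▸ h.on₁.2.1)
  have hB23 : B₂ ≠ B₃ := fun e => h.off₂.1 (e ▸ h.on₂.2.1)
  have hM12 : M₁ ≠ M₂ := fun e => h.off₂.2.1 (e ▸ h.on₂.2.2)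
  have hM13 : M₁ ≠ M₃ := fun e => h.off₃.2.1 (e ▸ h.on₃.2.2)
  have hM23 : M₂ ≠ M₃ := fun e => h.off₃.2.2 (e ▸ h.on₃.2.2)
  have hn1 : ∀ j ∈ J, ¬ t₁ ∣ m j := fun j hj hd => htwo j hj {B₂, B₃, M₁}
    (Finset.card_eq_three.2 ⟨_, _, _, hB23, h.ne₂.1, h.ne₃.1, rfl⟩) (by simp)
    (by simp [ev_eq_zero_of_dvd hd, h.on₁])
  have hn2 : ∀ j ∈ J, ¬ t₂ ∣ m j := fun j hj hd => htwo j hj {B₁, B₃, M₂}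
    (Finset.card_eq_three.2 ⟨_, _, _, hB13, h.ne₁.1, h.ne₃.2, rfl⟩) (by simp)
    (by simp [ev_eq_zero_of_dvd hd, h.on₂])
  have hn3 : ∀ j ∈ J, ¬ t₃ ∣ m j := fun j hj hd => htwo j hj {B₁, B₂, M₃}
    (Finset.card_eq_three.2 ⟨_, _, _, hB12, h.ne₁.2, h.ne₂.2, rfl⟩) (by simp)
    (by simp [ev_eq_zero_of_dvd hd, h.on₃])
  obtain ⟨j, hj, hjB⟩ := hcov B₂ (h.mem_freeNodes_of_off hD (by simp) hl.offB₂)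
  obtain ⟨k, hk, hkB⟩ := hcov B₃ (h.mem_freeNodes_of_off hD (by simp) hl.offB₃)
  by_contra hcon
  push Not at hcon
  have hjM2 := (hcon j).1 hjB
  have hkM3 := (hcon k).2 hkB
  have hjB3 : ev (m j) B₃ ≠ 0 := fun h0 =>
    hn1 j hj (dvd_of_two_points h.line₁ (hm j) hB23 h.on₁.1 h.on₁.2.1 hjB h0)
  have hjM1 : ev (m j) M₁ ≠ 0 := fun h0 =>
    hn1 j hj (dvd_of_two_points h.line₁ (hm j) h.ne₂.1 h.on₁.1 h.on₁.2.2 hjB h0)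
  have hjM3 : ev (m j) M₃ ≠ 0 := fun h0 =>
    hn3 j hj (dvd_of_two_points h.line₃ (hm j) h.ne₂.2 h.on₃.2.1 h.on₃.2.2 hjB h0)
  have hkM1 : ev (m k) M₁ ≠ 0 := fun h0 =>
    hn1 k hk (dvd_of_two_points h.line₁ (hm k) h.ne₃.1 h.on₁.2.1 h.on₁.2.2 hkB h0)
  have hkM2 : ev (m k) M₂ ≠ 0 := fun h0 =>
    hn2 k hk (dvd_of_two_points h.line₂ (hm k) h.ne₃.2 h.on₂.2.1 h.on₂.2.2 hkB h0)
  have hjk : j ≠ k := fun e => hjB3 (e ▸ hkB)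
  obtain ⟨o, ho⟩ : ∃ o, (J.erase j).erase k = {o} := Finset.card_eq_one.1 (by
    rw [Finset.card_erase_of_mem (Finset.mem_erase.2 ⟨hjk.symm, hk⟩),
      Finset.card_erase_of_mem hj, hJ])
  have hoJ : o ∈ J := Finset.mem_of_mem_erase (Finset.mem_of_mem_erase (a := k)
    (ho ▸ Finset.mem_singleton_self o))
  have hon : ∀ A ∈ freeNodes X l D, ev (m j) A ≠ 0 → ev (m k) A ≠ 0 → ev (m o) A = 0 := by
    intro A hA hjA hkA
    obtain ⟨i, hi, hiA⟩ := hcov A hA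
    have hmem : i ∈ (J.erase j).erase k := Finset.mem_erase.2
      ⟨fun e => hkA (e ▸ hiA), Finset.mem_erase.2 ⟨fun e => hjA (e ▸ hiA), hi⟩⟩
    rw [ho, Finset.mem_singleton] at hmem
    exact hmem ▸ hiA
  refine htwo o hoJ {M₁, M₂, M₃} (Finset.card_eq_three.2 ⟨_, _, _, hM12, hM13, hM23, rfl⟩)
    (by simp) ?_
  simp only [Finset.mem_insert, Finset.mem_singleton, forall_eq_or_imp, forall_eq]
  exact ⟨hon _ (h.mem_freeNodes_of_off hD (by simp) hl.offM₁) hjM1 hkM1,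
    hon _ (h.mem_freeNodes_of_off hD (by simp) hl.offM₂) hjM2 hkM2,
    hon _ (h.mem_freeNodes_of_off hD (by simp) hl.offM₃) hjM3 hkM3⟩

/-- Let `r`, `s`, `s'` be pairwise node-disjoint 5-node lines such that `l` meets `r` only in the
node `B` and is different from `s'`. A node using `l` and `s` uses `r` too. -/
theorem uses_of_cover {r s s' : MvPolynomial (Fin 2) ℝ}
    (hl : IsLinePoly l) (hr : IsLinePoly r) (hs : IsLinePoly s) (hs' : IsLinePoly s')
    (hr5 : (nodes X r).card = 5) (hs'5 : (nodes X s').card = 5)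
    (hrs : ∀ A ∈ X, ev s A = 0 → ev r A ≠ 0) (hss' : ∀ A ∈ X, ev s A = 0 → ev s' A ≠ 0)
    (hrs' : ∀ A ∈ X, ev s' A = 0 → ev r A ≠ 0) {B : ℝ × ℝ}
    (hB : ∀ A, ev r A = 0 → ev l A = 0 → A = B) (hls' : ¬ l ∣ s') {D : ℝ × ℝ}
    (m : Fin 4 → MvPolynomial (Fin 2) ℝ) (hm : ∀ i, IsLinePoly (m i))
    (hmD : ∀ i, ev (m i) D ≠ 0) (huse : ∀ i q, q ∣ m i → Uses 5 (X : Set (ℝ × ℝ)) D q)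
    (hcov : ∀ A ∈ X, A ≠ D → ev l A ≠ 0 → ∃ i, ev (m i) A = 0) {j : Fin 4} (hj : s ∣ m j) :
    Uses 5 (X : Set (ℝ × ℝ)) D r := by
  classical
  have hjs : ∀ A, ev s A ≠ 0 → ev (m j) A ≠ 0 := fun A => ev_ne_zero_of_dvd hs (hm j) hj
  have hcard := (nodes X r).pred_card_le_card_erase (a := B)
  rw [hr5] at hcard
  have hr' : ∀ A ∈ (nodes X r).erase B, A ∈ X ∧ ev r A = 0 ∧ ev l A ≠ 0 := by
    intro A hA
    obtain ⟨hAB, hA⟩ := Finset.mem_erase.1 hA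
    obtain ⟨hAX, hAr⟩ := mem_nodes.1 hA
    exact ⟨hAX, hAr, fun h0 => hAB (hB A hAr h0)⟩
  by_cases hD : ev r D = 0
  · have hsub : ∃ E, nodes X s' \ offNodes X s' l ⊆ {E} := by
      by_contra hcon
      push Not at hcon
      obtain ⟨P, hP, -⟩ := Finset.not_subset.1 (hcon B)
      obtain ⟨Q, hQ, hQP⟩ := Finset.not_subset.1 (hcon P)
      have hmem : ∀ A ∈ nodes X s' \ offNodes X s' l, ev s' A = 0 ∧ ev l A = 0 := by
        intro A hA
        obtain ⟨hA, hA'⟩ := Finset.mem_sdiff.1 hA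
        obtain ⟨hAX, hAs⟩ := mem_nodes.1 hA
        refine ⟨hAs, ?_⟩
        by_contra h0
        exact hA' (mem_offNodes.2 ⟨hAX, hAs, h0⟩)
      exact hls' (dvd_of_two_points hl hs' (fun e => hQP (Finset.mem_singleton.2 e.symm))
        (hmem P hP).2 (hmem Q hQ).2 (hmem P hP).1 (hmem Q hQ).1)
    obtain ⟨E, hE⟩ := hsub
    have h1 := Finset.card_le_card hE
    have h2 := Finset.card_le_card_sdiff_add_card (s := nodes X s') (t := offNodes X s' l)
    rw [Finset.card_singleton] at h1
    rw [hs'5] at h2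
    obtain ⟨k, hk, hkd⟩ := exists_dvd_of_cover hs' (Finset.univ.erase j) m hm (offNodes X s' l)
      (fun A hA => (mem_offNodes.1 hA).2.1) (by
        intro A hA
        obtain ⟨hAX, hAs, hAl⟩ := mem_offNodes.1 hA
        obtain ⟨i, hi⟩ := hcov A hAX (fun e => hrs' A hAX hAs (e ▸ hD)) hAl
        exact ⟨i, Finset.mem_erase.2 ⟨fun e => hjs A (fun h0 => hss' A hAX h0 hAs) (e ▸ hi),
          Finset.mem_univ i⟩, hi⟩) (by
        rw [Finset.card_erase_of_mem (Finset.mem_univ j), Finset.card_univ, Fintype.card_fin]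
        omega)
    have hcard' := ((nodes X r).erase B).pred_card_le_card_erase (a := D)
    obtain ⟨i, -, hi⟩ := exists_dvd_of_cover hr ((Finset.univ.erase j).erase k) m hm
      (((nodes X r).erase B).erase D)
      (fun A hA => (hr' A (Finset.mem_of_mem_erase hA)).2.1) (by
        intro A hA
        obtain ⟨hAD, hA⟩ := Finset.mem_erase.1 hA
        obtain ⟨hAX, hAr, hAl⟩ := hr' A hA
        obtain ⟨i, hi⟩ := hcov A hAX hAD hAl
        refine ⟨i, Finset.mem_erase.2 ⟨fun e => ?_, Finset.mem_erase.2 ⟨fun e => ?_,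
          Finset.mem_univ i⟩⟩, hi⟩
        · exact ev_ne_zero_of_dvd hs' (hm k) hkd (fun h0 => hrs' A hAX h0 hAr) (e ▸ hi)
        · exact hjs A (fun h0 => hrs A hAX h0 hAr) (e ▸ hi)) (by
        rw [Finset.card_erase_of_mem hk, Finset.card_erase_of_mem (Finset.mem_univ j),
          Finset.card_univ, Fintype.card_fin]
        omega)
    exact absurd (ev_eq_zero_of_dvd hi hD) (hmD i)
  · obtain ⟨i, -, hi⟩ := exists_dvd_of_cover hr (Finset.univ.erase j) m hm ((nodes X r).erase B)
      (fun A hA => (hr' A hA).2.1) (by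
        intro A hA
        obtain ⟨hAX, hAr, hAl⟩ := hr' A hA
        obtain ⟨i, hi⟩ := hcov A hAX (fun e => hD (e ▸ hAr)) hAl
        exact ⟨i, Finset.mem_erase.2 ⟨fun e => hjs A (fun h0 => hrs A hAX h0 hAr) (e ▸ hi),
          Finset.mem_univ i⟩, hi⟩) (by
        rw [Finset.card_erase_of_mem (Finset.mem_univ j), Finset.card_univ, Fintype.card_fin]
        omega)
    exact huse i r hi

/-- If three nodes `D i` use the simple line `l`, they also use a 5-node median `r` through `B₁`
which is node-disjoint from the other two medians. -/
theorem Config.uses_median (h : Config X L t₁ t₂ t₃ B₁ B₂ B₃ M₁ M₂ M₃)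
    (hl : SimpleLine X L B₁ B₂ B₃ M₁ M₂ M₃ l) (hD : UserTriple X L l D)
    {r r₂ r₃ : MvPolynomial (Fin 2) ℝ} (hr : IsLinePoly r) (hrB : ev r B₁ = 0)
    (hrM : ev r M₁ = 0) (hr5 : (nodes X r).card = 5) (hr₂ : IsLinePoly r₂) (hr₃ : IsLinePoly r₃)
    (hB₂ : ev r₂ B₂ = 0) (hM₂ : ev r₂ M₂ = 0) (hB₃ : ev r₃ B₃ = 0) (hM₃ : ev r₃ M₃ = 0)
    (h₂5 : (nodes X r₂).card = 5) (h₃5 : (nodes X r₃).card = 5)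
    (h₂ : ∀ A ∈ X, ev r₂ A = 0 → ev r A ≠ 0 ∧ ev r₃ A ≠ 0)
    (h₃ : ∀ A ∈ X, ev r₃ A = 0 → ev r A ≠ 0) (a : Fin 3) :
    Uses 5 (X : Set (ℝ × ℝ)) (D a) r := by
  classical
  obtain ⟨-, m, hm, hmD, huse, hcov⟩ := Uses.exists_lines h.gc hl.line (hD.mem a) (hD.uses a)
  obtain ⟨i, hi⟩ := h.exists_redundant hl hD m hm fun A hA =>
    hcov A (mem_freeNodes.1 hA).1 ((mem_freeNodes.1 hA).2.2 a) (mem_freeNodes.1 hA).2.1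
  obtain ⟨j, hj⟩ := h.exists_median_of_cover hl hD m hm hmD (J := Finset.univ.erase i)
    (by rw [Finset.card_erase_of_mem (Finset.mem_univ i), Finset.card_univ, Fintype.card_fin]) hi
  have hB1X := (h.mem_off (A := B₁) (by simp)).1
  have hB : ∀ A, ev r A = 0 → ev l A = 0 → A = B₁ := by
    intro A hA hA'
    by_contra hne
    exact hl.offM₁ (ev_eq_zero_of_dvd (dvd_of_two_points hr hl.line hne hA hrB hA' hl.on) hrM)
  rcases hj with ⟨hj, hjM⟩ | ⟨hj, hjM⟩
  · have hne : B₂ ≠ M₂ := fun e => h.off₂.1 (e ▸ h.on₂.2.2)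
    exact uses_of_cover hl.line hr hr₂ hr₃ hr5 h₃5 (fun A hA hA' => (h₂ A hA hA').1)
      (fun A hA hA' => (h₂ A hA hA').2) h₃ hB
      (fun hd => h₃ B₁ hB1X (ev_eq_zero_of_dvd hd hl.on) hrB) m hm hmD huse hcov
      (dvd_of_two_points hr₂ (hm j) hne hB₂ hM₂ hj hjM)
  · have hne : B₃ ≠ M₃ := fun e => h.off₃.1 (e ▸ h.on₃.2.2)
    exact uses_of_cover hl.line hr hr₃ hr₂ hr5 h₂5 h₃
      (fun A hA hA' hA'' => (h₂ A hA hA'').2 hA') (fun A hA hA' => (h₂ A hA hA').1) hB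
      (fun hd => (h₂ B₁ hB1X (ev_eq_zero_of_dvd hd hl.on)).1 hrB) m hm hmD huse hcov
      (dvd_of_two_points hr₃ (hm j) hne hB₃ hM₃ hj hjM)

/-- A 4-node line through `B₁` used by a node of the union of the `L i` is not the side `t₃`. -/
theorem Config.not_side_dvd (h : Config X L t₁ t₂ t₃ B₁ B₂ B₃ M₁ M₂ M₃) (hl : IsLinePoly l)
    (hl4 : (nodes X l).card = 4) {P : ℝ × ℝ} (hP : P ∈ X) {a : Fin 3} (hPa : ev (L a) P = 0)
    (hu : Uses 5 (X : Set (ℝ × ℝ)) P l) : ¬ t₃ ∣ l := by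
  classical
  intro hd
  have hB12 : B₁ ≠ B₂ := fun e => h.off₁.1 (e ▸ h.on₁.1)
  have hS : ({B₁, B₂, M₃} : Finset (ℝ × ℝ)).card = 3 :=
    Finset.card_eq_three.2 ⟨_, _, _, hB12, h.ne₁.2, h.ne₂.2, rfl⟩
  have hoff : ∀ A ∈ ({B₁, B₂, M₃} : Finset (ℝ × ℝ)), A ∈ X ∧ ∀ i, ev (L i) A ≠ 0 :=
    fun A hA => h.mem_off (by simp at hA; tauto)
  have hsub : {B₁, B₂, M₃} ⊆ nodes X l := fun A hA => mem_nodes.2 ⟨(hoff A hA).1,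
    ev_eq_zero_of_dvd hd (by
      simp only [Finset.mem_insert, Finset.mem_singleton] at hA
      rcases hA with rfl | rfl | rfl
      exacts [h.on₃.1, h.on₃.2.1, h.on₃.2.2])⟩
  obtain ⟨E, hE⟩ := Finset.card_eq_one.1
    (show (nodes X l \ {B₁, B₂, M₃}).card = 1 by rw [Finset.card_sdiff_of_subset hsub, hl4, hS])
  have hEX := (mem_nodes.1 (Finset.mem_sdiff.1 (hE ▸ Finset.mem_singleton_self E)).1).1
  refine h.not_uses_of_single hl hEX (fun A hA hlA ⟨i, hi⟩ => ?_) hP hPa hu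
  exact Finset.mem_singleton.1 (hE ▸ Finset.mem_sdiff.2
    ⟨mem_nodes.2 ⟨hA, hlA⟩, fun hA' => (hoff A hA').2 i hi⟩)

/-- A 4-node line through `B₁` other than the median through `M₁` which is used by a node of the
union of the `L i` is simple. -/
theorem Config.simpleLine (h : Config X L t₁ t₂ t₃ B₁ B₂ B₃ M₁ M₂ M₃) (hl : IsLinePoly l)
    (hlB : ev l B₁ = 0) (hlM : ev l M₁ ≠ 0) (hl4 : (nodes X l).card = 4) {P : ℝ × ℝ}
    (hP : P ∈ X) {a : Fin 3} (hPa : ev (L a) P = 0) (hu : Uses 5 (X : Set (ℝ × ℝ)) P l) :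
    SimpleLine X L B₁ B₂ B₃ M₁ M₂ M₃ l := by
  classical
  have hB12 : B₁ ≠ B₂ := fun e => h.off₁.1 (e ▸ h.on₁.1)
  have hB13 : B₁ ≠ B₃ := fun e => h.off₁.1 (e ▸ h.on₁.2.1)
  have hn3 := h.not_side_dvd hl hl4 hP hPa hu
  have hn2 := h.swap.not_side_dvd hl hl4 hP hPa hu
  have hB₂ : ev l B₂ ≠ 0 := fun h0 =>
    hn3 (dvd_of_two_points h.line₃ hl hB12 h.on₃.1 h.on₃.2.1 hlB h0)
  have hM₃ : ev l M₃ ≠ 0 := fun h0 =>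
    hn3 (dvd_of_two_points h.line₃ hl h.ne₁.2 h.on₃.1 h.on₃.2.2 hlB h0)
  have hB₃ : ev l B₃ ≠ 0 := fun h0 =>
    hn2 (dvd_of_two_points h.line₂ hl hB13 h.on₂.1 h.on₂.2.1 hlB h0)
  have hM₂ : ev l M₂ ≠ 0 := fun h0 =>
    hn2 (dvd_of_two_points h.line₂ hl h.ne₁.1 h.on₂.1 h.on₂.2.2 hlB h0)
  have hle : ∀ i, ((nodes X (L i)).filter fun A => ev l A = 0).card ≤ 1 := by
    intro i
    refine Finset.card_le_one.2 fun A hA B hB => ?_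
    obtain ⟨hA, hA'⟩ := Finset.mem_filter.1 hA
    obtain ⟨hB, hB'⟩ := Finset.mem_filter.1 hB
    by_contra hne
    exact (h.mem_off (A := B₁) (by simp)).2 i (ev_eq_zero_of_dvd (dvd_of_two_points hl (h.line i)
      hne hA' hB' (mem_nodes.1 hA).2 (mem_nodes.1 hB).2) hlB)
  have hsub : (nodes X l).erase B₁ ⊆
      Finset.univ.biUnion fun i => (nodes X (L i)).filter fun A => ev l A = 0 := by
    intro A hA
    obtain ⟨hAB, hA⟩ := Finset.mem_erase.1 hA
    obtain ⟨hAX, hlA⟩ := mem_nodes.1 hA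
    by_contra hcon
    have hoff : ∀ i, ev (L i) A ≠ 0 := fun i hi => hcon (Finset.mem_biUnion.2
      ⟨i, Finset.mem_univ i, Finset.mem_filter.2 ⟨mem_nodes.2 ⟨hAX, hi⟩, hlA⟩⟩)
    rcases (h.off_iff A).1 ⟨hAX, hoff⟩ with rfl | rfl | rfl | rfl | rfl | rfl
    exacts [hAB rfl, hB₂ hlA, hB₃ hlA, hlM hlA, hM₂ hlA, hM₃ hlA]
  have hsum := (Finset.card_le_card hsub).trans Finset.card_biUnion_le
  rw [Finset.card_erase_of_mem (mem_nodes.2 ⟨(h.mem_off (by simp)).1, hlB⟩), hl4,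
    Fin.sum_univ_three] at hsum
  refine ⟨hl, hl4, hlB, hB₂, hB₃, hlM, hM₂, hM₃, fun i => ?_⟩
  have heq : offNodes X (L i) l = (nodes X (L i)).filter fun A => ¬ ev l A = 0 := by
    ext A
    simp [mem_offNodes, mem_nodes, and_assoc]
  have hadd := Finset.card_filter_add_card_filter_not (s := nodes X (L i)) fun A => ev l A = 0
  rw [h.card_nodes, ← heq] at hadd
  have h0 := hle 0
  have h1 := hle 1
  have h2 := hle 2
  fin_cases i <;> simp only [Fin.zero_eta, Fin.mk_one, Fin.reduceFinMk] at hadd ⊢ <;> omega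

/-- The three users of a 4-node line through `B₁` belong to any six-element set of users of the
5-node median through `B₁`. -/
theorem Config.users_mem (h : Config X L t₁ t₂ t₃ B₁ B₂ B₃ M₁ M₂ M₃)
    {r : MvPolynomial (Fin 2) ℝ} (hr : IsLinePoly r) (hrB : ev r B₁ = 0) (hrM : ev r M₁ = 0)
    (hr5 : (nodes X r).card = 5) {U : Finset (ℝ × ℝ)} (hUX : U ⊆ X) (hU : U.card = 6)
    (hUL : ∀ P ∈ U, ∃ i, ev (L i) P = 0) (huse : ∀ P ∈ U, Uses 5 (X : Set (ℝ × ℝ)) P r)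
    (hl : IsLinePoly l) (hlB : ev l B₁ = 0) (hl4 : (nodes X l).card = 4)
    {P : Fin 3 → ℝ × ℝ} (hinj : Function.Injective P) (hPX : ∀ s, P s ∈ X)
    (hPL : ∀ s, ∃ i, ev (L i) (P s) = 0) (hPu : ∀ s, Uses 5 (X : Set (ℝ × ℝ)) (P s) l)
    (s : Fin 3) : P s ∈ U := by
  classical
  have hlM : ev l M₁ ≠ 0 := by
    intro h0
    have hne : B₁ ≠ M₁ := fun e => h.off₁.1 (e ▸ h.on₁.2.2)
    have hd := dvd_of_two_points hl hr hne hlB h0 hrB hrM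
    have heq : nodes X l = nodes X r := by
      ext A
      exact mem_nodes.trans ((and_congr_right fun _ => ⟨ev_eq_zero_of_dvd hd,
        ev_eq_zero_of_dvd (dvd_symm_of_isLinePoly hl hr hd)⟩).trans mem_nodes.symm)
    rw [heq, hr5] at hl4
    omega
  choose f hf using hPL
  have hs := h.simpleLine hl hlB hlM hl4 (hPX 0) (hf 0) (hPu 0)
  have hfinj : Function.Injective f := by
    intro x y hxy
    by_contra hne
    obtain ⟨z, hxz, hyz⟩ : ∃ z, x ≠ z ∧ y ≠ z := by
      clear * -
      revert x y
      decide
    exact h.users_not_on_same hs (hPX x) (hPX y) (hPX z) (hinj.ne hne) (hinj.ne hxz)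
      (hinj.ne hyz) (hPu x) (hPu y) (hPu z) (hf x) (hxy ▸ hf y) (hf z)
  let e := Equiv.ofBijective f (Finite.injective_iff_bijective.1 hfinj)
  have he : ∀ i, ev (L i) (P (e.symm i)) = 0 := fun i => by
    have := hf (e.symm i)
    rwa [show f (e.symm i) = i from e.apply_symm_apply i] at this
  have hD : UserTriple X L l (fun i => P (e.symm i)) := ⟨fun i => hPX _, he, fun i => hPu _,
    fun i => (Uses.exists_lines h.gc hl (hPX _) (hPu _)).1⟩
  obtain ⟨hmem, r₂, r₃, hr₂, hr₃, hB₂, hM₂, hB₃, hM₃, h₂5, h₃5, h₂, h₃⟩ :=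
    h.exists_medians hr hrB hrM hr5 hUX hU hUL huse
  have := h.uses_median hs hD hr hrB hrM hr5 hr₂ hr₃ hB₂ hM₂ hB₃ hM₃ h₂5 h₃5 h₂ h₃ (e s)
  rw [e.symm_apply_apply] at this
  exact hmem _ (hPX s) this

end Config

/-- A line with five primary nodes contains no further node. -/
theorem card_nodes_of_resCount {X : Finset (ℝ × ℝ)} {L : Fin 5 → MvPolynomial (Fin 2) ℝ}
    {s : Fin 5} (hle : (nodes X (L s)).card ≤ 5)
    (h : resCount (X : Set (ℝ × ℝ)) L s (L s) = 5) :
    (nodes X (L s)).card = 5 ∧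
      ∀ A ∈ X, ev (L s) A = 0 → ∀ i < s, ev (L i) A ≠ 0 := by
  classical
  have hset : {B ∈ (X : Set (ℝ × ℝ)) | ev (L s) B = 0 ∧ ∀ i : Fin 5, i < s → ev (L i) B ≠ 0} =
      ↑((nodes X (L s)).filter fun B => ∀ i < s, ev (L i) B ≠ 0) := by
    ext A
    simp [mem_nodes, and_assoc]
  rw [resCount, hset, Set.ncard_coe_finset] at h
  have heq := Finset.eq_of_subset_of_card_le (Finset.filter_subset
    (fun B => ∀ i < s, ev (L i) B ≠ 0) (nodes X (L s))) (by omega)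
  exact ⟨heq ▸ h, fun A hA hsA => (Finset.mem_filter.1 (heq ▸ mem_nodes.2 ⟨hA, hsA⟩)).2⟩

/-- in the `(5,5,5,3,2)` setup, with `ℬ = {B1, B2, B3, M1, M2, M3}` labeled
so that the lines through `{B2,B3,M1}`, `{B1,B3,M2}`, `{B1,B2,M3}` are the maximal lines of
the `GC_2` set `ℬ`: if the line through `B1` and `M1` is a 5-node line of `X` used by all
six nodes of a six-element subset `A6 ⊆ 𝒜`, and `l` is a 4-node line of `X` through `B1`
used by three nodes of `𝒜`, then these three nodes all belong to `A6`. -/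
theorem three_users_in_A6
    (X : Set (ℝ × ℝ)) (hX : GCSet 5 X) (hnm : NoMaximalLine 5 X)
    (A0 : ℝ × ℝ) (hA0 : A0 ∈ X) (L : Fin 5 → MvPolynomial (Fin 2) ℝ)
    (hL : MLineSeq X A0 L) (hk : ∀ s, resCount X L s (L s) = ![5, 5, 5, 3, 2] s)
    (SA SB : Set (ℝ × ℝ))
    (hSA : SA = X ∩ (lineSet (L 0) ∪ lineSet (L 1) ∪ lineSet (L 2)))
    (hSB : SB = X \ SA)
    (B1 B2 B3 M1 M2 M3 : ℝ × ℝ)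
    (hlabel : SB = {B1, B2, B3, M1, M2, M3})
    (hnodup : ([B1, B2, B3, M1, M2, M3] : List (ℝ × ℝ)).Nodup)
    (ht1 : ∃ t : MvPolynomial (Fin 2) ℝ, IsLinePoly t ∧ SB ∩ lineSet t = {B2, B3, M1})
    (ht2 : ∃ t : MvPolynomial (Fin 2) ℝ, IsLinePoly t ∧ SB ∩ lineSet t = {B1, B3, M2})
    (ht3 : ∃ t : MvPolynomial (Fin 2) ℝ, IsLinePoly t ∧ SB ∩ lineSet t = {B1, B2, M3})
    (lBM : MvPolynomial (Fin 2) ℝ) (hlBM : IsLinePoly lBM)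
    (hB1on : B1 ∈ lineSet lBM) (hM1on : M1 ∈ lineSet lBM)
    (hlBM5 : nodesOn X lBM = 5)
    (A6 : Set (ℝ × ℝ)) (hA6sub : A6 ⊆ SA) (hA6card : A6.ncard = 6)
    (hA6use : ∀ P ∈ A6, Uses 5 X P lBM)
    (l : MvPolynomial (Fin 2) ℝ) (hl : IsLinePoly l) (hB1l : B1 ∈ lineSet l)
    (hl4 : nodesOn X l = 4)
    (D1 D2 D3 : ℝ × ℝ) (hD1 : D1 ∈ SA) (hD2 : D2 ∈ SA) (hD3 : D3 ∈ SA)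
    (hD12 : D1 ≠ D2) (hD13 : D1 ≠ D3) (hD23 : D2 ≠ D3)
    (hDu1 : Uses 5 X D1 l) (hDu2 : Uses 5 X D2 l) (hDu3 : Uses 5 X D3 l) :
    D1 ∈ A6 ∧ D2 ∈ A6 ∧ D3 ∈ A6 := by
  classical
  obtain ⟨X, rfl⟩ := hX.1.1.exists_finset_coe
  obtain ⟨U, rfl⟩ := (Set.finite_of_ncard_pos (by omega : 0 < A6.ncard)).exists_finset_coe
  have hle : ∀ m, IsLinePoly m → (nodes X m).card ≤ 5 := fun m hm => hX.card_nodes_le hnm hm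
  have hres : ∀ i : Fin 3, (nodes X (L (Fin.castLE (by omega) i))).card = 5 ∧
      ∀ A ∈ X, ev (L (Fin.castLE (by omega) i)) A = 0 →
        ∀ j < Fin.castLE (by omega) i, ev (L j) A ≠ 0 := fun i =>
    card_nodes_of_resCount (hle _ (hL.1 _)) (by
      rw [hk]
      fin_cases i <;> rfl)
  have hSA' : ∀ A, A ∈ SA ↔ A ∈ X ∧ ∃ i : Fin 3, ev (L (Fin.castLE (by omega) i)) A = 0 := by
    intro A
    rw [hSA, Fin.exists_fin_succ]
    simp [Fin.exists_fin_two, lineSet, or_assoc]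
  have hSB' : ∀ A, (A ∈ X ∧ ∀ i : Fin 3, ev (L (Fin.castLE (by omega) i)) A ≠ 0) ↔ A ∈ SB := by
    intro A
    rw [hSB, Set.mem_sdiff, hSA', Finset.mem_coe]
    push Not
    tauto
  obtain ⟨t₁, ht₁, h₁⟩ := ht1
  obtain ⟨t₂, ht₂, h₂⟩ := ht2
  obtain ⟨t₃, ht₃, h₃⟩ := ht3
  have hB : ∀ A, A ∈ SB ↔ A = B1 ∨ A = B2 ∨ A = B3 ∨ A = M1 ∨ A = M2 ∨ A = M3 := by
    simp [hlabel]
  have hon : ∀ {t P Q R}, SB ∩ lineSet t = {P, Q, R} →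
      ∀ A ∈ SB, (ev t A = 0 ↔ A = P ∨ A = Q ∨ A = R) := by
    intro t P Q R h A hA
    have := Set.ext_iff.1 h A
    simpa [hA, lineSet] using this
  simp only [List.nodup_cons, List.mem_cons, List.not_mem_nil, or_false, not_or,
    List.nodup_nil, not_false_eq_true, and_true] at hnodup
  have hconf : Config X (fun i => L (Fin.castLE (by omega) i)) t₁ t₂ t₃ B1 B2 B3 M1 M2 M3 := by
    refine ⟨hX, ?_, hle, fun i => hL.1 _, fun i => (hres i).1, ?_, fun A => (hSB' A).trans (hB A),
      ht₁, ht₂, ht₃, ?_, ?_, ?_, ?_, ?_, ?_, ?_, ?_, ?_⟩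
    · have := hX.1.2.1
      rwa [Set.ncard_coe_finset] at this
    · intro i j hij A hA hi hj
      rcases lt_or_gt_of_ne hij with hlt | hlt
      · exact (hres j).2 A hA hj _ hlt hi
      · exact (hres i).2 A hA hi _ hlt hj
    all_goals
      simp only [hon h₁, hon h₂, hon h₃, hB, true_or, or_true, ne_eq]
      grind
  have hUX : U ⊆ X := fun A hA => ((hSA' A).1 (hA6sub hA)).1
  have hmem := hconf.users_mem hlBM hB1on hM1on (nodesOn_coe X lBM ▸ hlBM5) hUX
    (Set.ncard_coe_finset U ▸ hA6card) (fun A hA => ((hSA' A).1 (hA6sub hA)).2)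
    (fun A hA => hA6use A hA) hl hB1l (nodesOn_coe X l ▸ hl4) (P := ![D1, D2, D3]) (by
      intro x y
      fin_cases x <;> fin_cases y <;> simp [hD12, hD13, hD23, hD12.symm, hD13.symm, hD23.symm])
    (Fin.forall_fin_succ.2 ⟨((hSA' _).1 hD1).1, Fin.forall_fin_two.2
      ⟨((hSA' _).1 hD2).1, ((hSA' _).1 hD3).1⟩⟩)
    (Fin.forall_fin_succ.2 ⟨((hSA' _).1 hD1).2, Fin.forall_fin_two.2
      ⟨((hSA' _).1 hD2).2, ((hSA' _).1 hD3).2⟩⟩)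
    (Fin.forall_fin_succ.2 ⟨hDu1, Fin.forall_fin_two.2 ⟨hDu2, hDu3⟩⟩)
  exact ⟨hmem 0, hmem 1, hmem 2⟩
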